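/- arXiv:2106.14836 — 10 statements merged into one kernel-verified Lean document; each statement's English description precedes it below -/
import Mathlib

section
/- Assume the common model structure assumption holds with set S, that each ℓ_i is differentiable and convex on ℝ^{m_y}, and that each map θ ↦ f(x_i,θ) is differentiable at a point θ ∈ ℝ^d. Then for every β ∈ ℝ^d, L(θ) ≤ L_θ(β) + ‖ν(θ) − β‖·‖∇L(θ)‖, where L_θ(β) = (1/n) Σ_{i=1}^n ℓ( Σ_{k=1}^d β_k · ∂f(x_i,θ)/∂θ_k , y_i ) and ‖·‖ is the Euclidean norm. (Key lemma, Lemma 1 of the appendix.) -/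
/-- A convex function lies above its tangent hyperplanes. -/
theorem ConvexOn.add_fderiv_sub_le {E : Type*} [NormedAddCommGroup E] [NormedSpace ℝ E]
    {φ : E → ℝ} {φ' : E →L[ℝ] ℝ} {p : E} (hφ : ConvexOn ℝ Set.univ φ)
    (hφ' : HasFDerivAt φ φ' p) (q : E) : φ p + φ' (q - p) ≤ φ q := by
  have hconv : ConvexOn ℝ Set.univ (φ ∘ AffineMap.lineMap (k := ℝ) p q) :=
    hφ.comp_affineMap (AffineMap.lineMap (k := ℝ) p q)
  have hderiv : HasDerivAt (φ ∘ AffineMap.lineMap (k := ℝ) p q) (φ' (q - p)) 0 := by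
    refine HasFDerivAt.comp_hasDerivAt (0 : ℝ) ?_ AffineMap.hasDerivAt_lineMap
    simpa using hφ'
  have h := hconv.le_slope_of_hasDerivAt (Set.mem_univ 0) (Set.mem_univ 1) one_pos hderiv
  simp only [slope_def_field, Function.comp_apply, AffineMap.lineMap_apply_zero,
    AffineMap.lineMap_apply_one, sub_zero, div_one] at h
  linarith

/-- A linear map out of Euclidean space is determined by its values on the standard basis. -/
theorem ContinuousLinearMap.apply_eq_sum_single {d : ℕ} {F : Type*} [NormedAddCommGroup F]
    [NormedSpace ℝ F] (A : EuclideanSpace ℝ (Fin d) →L[ℝ] F) (β : EuclideanSpace ℝ (Fin d)) :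
    A β = ∑ k, β k • A (EuclideanSpace.single k 1) := by
  conv_lhs => rw [← (EuclideanSpace.basisFun (Fin d) ℝ).sum_repr β]
  simp

/-- Lemma 1 of the appendix (`lemma:pgd_approx`): under the common model structure assumption,
with differentiable convex losses `ℓ_i` and `f_i` differentiable at `θ`, for every `β`,
`L(θ) ≤ L_θ(β) + ‖ν(θ) − β‖ ‖∇L(θ)‖`, where
`L_θ(β) = (1/n) Σ_i ℓ(Σ_k β_k ∂f(x_i,θ)/∂θ_k, y_i)` and `ν(θ)` keeps the coordinates of `θ`
in `S` and zeroes out the rest. -/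
theorem stmt_1
    (n mx my d : ℕ) (hn : 0 < n)
    (x : Fin n → EuclideanSpace ℝ (Fin mx))
    (y : Fin n → EuclideanSpace ℝ (Fin my))
    (f : EuclideanSpace ℝ (Fin mx) → EuclideanSpace ℝ (Fin d) → EuclideanSpace ℝ (Fin my))
    (ℓ : EuclideanSpace ℝ (Fin my) → EuclideanSpace ℝ (Fin my) → ℝ)
    (hℓnn : ∀ p q, 0 ≤ ℓ p q)
    -- common model structure assumption
    (S : Finset (Fin d))
    (hCMS : ∀ (i : Fin n) (θ' : EuclideanSpace ℝ (Fin d)),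
      f (x i) θ' = ∑ k ∈ S, θ' k • fderiv ℝ (f (x i)) θ' (EuclideanSpace.single k 1))
    -- each ℓ_i is differentiable and convex on ℝ^{m_y}
    (hℓdiff : ∀ i, Differentiable ℝ (fun q => ℓ q (y i)))
    (hℓconv : ∀ i, ConvexOn ℝ Set.univ (fun q => ℓ q (y i)))
    (θ : EuclideanSpace ℝ (Fin d))
    (hfdiff : ∀ i, DifferentiableAt ℝ (f (x i)) θ)
    (L : EuclideanSpace ℝ (Fin d) → ℝ)
    (hL : ∀ θ', L θ' = (1 / (n : ℝ)) * ∑ i, ℓ (f (x i) θ') (y i))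
    (β : EuclideanSpace ℝ (Fin d)) :
    L θ ≤ (1 / (n : ℝ)) *
        ∑ i, ℓ (∑ k, β k • fderiv ℝ (f (x i)) θ (EuclideanSpace.single k 1)) (y i) +
      ‖(∑ k ∈ S, EuclideanSpace.single k (θ k)) - β‖ * ‖gradient L θ‖ := by
  have hν (i : Fin n) : fderiv ℝ (f (x i)) θ (∑ k ∈ S, EuclideanSpace.single k (θ k)) =
      f (x i) θ := by
    rw [hCMS i θ, map_sum]
    refine Finset.sum_congr rfl fun k _ => ?_
    rw [← map_smul]
    congr 1
    ext j
    simp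
  set ν := ∑ k ∈ S, EuclideanSpace.single k (θ k)
  have hcomp (i : Fin n) : HasFDerivAt (fun θ' => ℓ (f (x i) θ') (y i))
      ((fderiv ℝ (fun q => ℓ q (y i)) (f (x i) θ)).comp (fderiv ℝ (f (x i)) θ)) θ :=
    (hℓdiff i (f (x i) θ)).hasFDerivAt.comp θ (hfdiff i).hasFDerivAt
  have hLderiv : HasFDerivAt L ((1 / (n : ℝ)) •
      ∑ i, (fderiv ℝ (fun q => ℓ q (y i)) (f (x i) θ)).comp (fderiv ℝ (f (x i)) θ)) θ := by
    rw [funext hL]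
    exact (HasFDerivAt.fun_sum fun i _ => hcomp i).const_mul _
  have htangent (i : Fin n) : ℓ (f (x i) θ) (y i) ≤
      ℓ (fderiv ℝ (f (x i)) θ β) (y i) +
        fderiv ℝ (fun q => ℓ q (y i)) (f (x i) θ) (fderiv ℝ (f (x i)) θ (ν - β)) := by
    have h := (hℓconv i).add_fderiv_sub_le (hℓdiff i (f (x i) θ)).hasFDerivAt
      (fderiv ℝ (f (x i)) θ β)
    rw [map_sub, hν]
    rw [map_sub] at h ⊢
    linarith
  have hgrad : fderiv ℝ L θ (ν - β) ≤ ‖ν - β‖ * ‖gradient L θ‖ := by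
    rw [← inner_gradient_left, mul_comm]
    exact real_inner_le_norm _ _
  simp_rw [← ContinuousLinearMap.apply_eq_sum_single]
  calc L θ ≤ (1 / (n : ℝ)) * ∑ i, (ℓ (fderiv ℝ (f (x i)) θ β) (y i) +
        fderiv ℝ (fun q => ℓ q (y i)) (f (x i) θ) (fderiv ℝ (f (x i)) θ (ν - β))) := by
        rw [hL]
        gcongr with i
        exact htangent i
    _ = (1 / (n : ℝ)) * ∑ i, ℓ (fderiv ℝ (f (x i)) θ β) (y i) + fderiv ℝ L θ (ν - β) := by
        rw [hLderiv.fderiv, Finset.sum_add_distrib, mul_add]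
        simp only [smul_apply, sum_apply, ContinuousLinearMap.comp_apply, smul_eq_mul]
    _ ≤ _ := by gcongr
end

section
/- Assume the common model structure assumption, that each ℓ_i is differentiable and convex, and that each map θ ↦ f(x_i,θ) is differentiable at θ ∈ ℝ^d (so that J(θ) exists). If ∇L(θ) = 0 and vec(Y*) ∈ Col(J(θ)) for some Y* ∈ ℝ^{n×m_y}, then L(θ) ≤ L*(η·Y*) for every η ∈ ℝ. (Stationarity together with the data-architecture alignment condition implies global optimality; the key step in the proofs of Theorems 3 and 4.) -/
/-- A convex function lies above its tangent hyperplanes. -/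
theorem ConvexOn.add_fderiv_sub_le_s2 {E : Type*} [NormedAddCommGroup E] [NormedSpace ℝ E]
    {g : E → ℝ} {s : Set E} {g' : E →L[ℝ] ℝ} {p q : E} (hg : ConvexOn ℝ s g)
    (hp : p ∈ s) (hq : q ∈ s) (hg' : HasFDerivAt g g' p) :
    g p + g' (q - p) ≤ g q := by
  have hline : HasDerivAt (g ∘ AffineMap.lineMap (k := ℝ) p q) (g' (q - p)) 0 := by
    refine HasFDerivAt.comp_hasDerivAt (0 : ℝ) ?_ AffineMap.hasDerivAt_lineMap
    simpa using hg'
  have hslope := (hg.comp_affineMap (AffineMap.lineMap (k := ℝ) p q)).le_slope_of_hasDerivAt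
    (x := 0) (y := 1) (by simpa using hp) (by simpa using hq) one_pos hline
  simp only [slope_def_field, Function.comp_apply, AffineMap.lineMap_apply_zero,
    AffineMap.lineMap_apply_one, sub_zero, div_one] at hslope
  linarith

/-- Stationarity together with the data-architecture alignment condition implies global
optimality (key step in the proofs of Theorems 3 and 4): under the common model structure
assumption, with differentiable convex losses and `f_i` differentiable at `θ`, if `∇L(θ) = 0`
and `vec(Y*) ∈ Col(J(θ))`, then `L(θ) ≤ L*(η • Y*)` for every `η ∈ ℝ`. Here the alignment
condition is expressed as membership of `Y*` in the range of the Fréchet derivative of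
`θ ↦ f_X(θ)` at `θ`. -/
theorem stmt_2
    (n mx my d : ℕ) (hn : 0 < n)
    (x : Fin n → EuclideanSpace ℝ (Fin mx))
    (y : Fin n → EuclideanSpace ℝ (Fin my))
    (f : EuclideanSpace ℝ (Fin mx) → EuclideanSpace ℝ (Fin d) → EuclideanSpace ℝ (Fin my))
    (fX : EuclideanSpace ℝ (Fin d) → Fin n → EuclideanSpace ℝ (Fin my))
    (hfX : ∀ θ' i, fX θ' i = f (x i) θ')
    (ℓ : EuclideanSpace ℝ (Fin my) → EuclideanSpace ℝ (Fin my) → ℝ)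
    (hℓnn : ∀ p q, 0 ≤ ℓ p q)
    -- common model structure assumption
    (S : Finset (Fin d))
    (hCMS : ∀ (i : Fin n) (θ' : EuclideanSpace ℝ (Fin d)),
      f (x i) θ' = ∑ k ∈ S, θ' k • fderiv ℝ (f (x i)) θ' (EuclideanSpace.single k 1))
    -- each ℓ_i is differentiable and convex
    (hℓdiff : ∀ i, Differentiable ℝ (fun q => ℓ q (y i)))
    (hℓconv : ∀ i, ConvexOn ℝ Set.univ (fun q => ℓ q (y i)))
    (θ : EuclideanSpace ℝ (Fin d))
    (hfdiff : ∀ i, DifferentiableAt ℝ (f (x i)) θ)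
    (L : EuclideanSpace ℝ (Fin d) → ℝ)
    (hL : ∀ θ', L θ' = (1 / (n : ℝ)) * ∑ i, ℓ (f (x i) θ') (y i))
    -- stationarity
    (hstat : gradient L θ = 0)
    -- data-architecture alignment condition at θ
    (Y : Fin n → EuclideanSpace ℝ (Fin my))
    (halign : Y ∈ Set.range (fderiv ℝ fX θ)) :
    ∀ η : ℝ, L θ ≤ (1 / (n : ℝ)) * ∑ i, ℓ (η • Y i) (y i) := by
  intro η
  obtain ⟨v, rfl⟩ := halign
  have hfX_eq : fX = fun θ' i => f (x i) θ' := funext fun θ' => funext fun i => hfX θ' i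
  have hY : ∀ i, fderiv ℝ fX θ v i = fderiv ℝ (f (x i)) θ v := by
    intro i
    rw [hfX_eq, fderiv_pi hfdiff]
    rfl
  have hfderiv : HasFDerivAt L ((1 / (n : ℝ)) • ∑ i, (fderiv ℝ (fun q => ℓ q (y i))
      (f (x i) θ)).comp (fderiv ℝ (f (x i)) θ)) θ := by
    rw [funext hL]
    refine HasFDerivAt.const_mul (HasFDerivAt.fun_sum fun i _ => ?_) _
    exact (hℓdiff i (f (x i) θ)).hasFDerivAt.comp θ (hfdiff i).hasFDerivAt
  have hzero : fderiv ℝ L θ = 0 := by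
    simpa [gradient] using hstat
  rw [hfderiv.fderiv] at hzero
  have hn' : (0 : ℝ) < 1 / n := by positivity
  have hsum : ∀ w, ∑ i, fderiv ℝ (fun q => ℓ q (y i)) (f (x i) θ)
      (fderiv ℝ (f (x i)) θ w) = 0 := by
    intro w
    simpa using congrArg (· w) ((smul_eq_zero.mp hzero).resolve_left hn'.ne')
  have hout : ∀ i, f (x i) θ =
      fderiv ℝ (f (x i)) θ (∑ k ∈ S, θ k • EuclideanSpace.single k 1) := by
    intro i
    rw [map_sum]
    simpa only [map_smul] using hCMS i θ
  rw [hL]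
  refine mul_le_mul_of_nonneg_left ?_ hn'.le
  have htangent := Finset.sum_le_sum fun i (_ : i ∈ Finset.univ) =>
    (hℓconv i).add_fderiv_sub_le_s2 (Set.mem_univ (f (x i) θ))
      (Set.mem_univ (η • fderiv ℝ fX θ v i)) (hℓdiff i (f (x i) θ)).hasFDerivAt
  have hdir : ∀ i, η • fderiv ℝ fX θ v i - f (x i) θ =
      fderiv ℝ (f (x i)) θ (η • v - ∑ k ∈ S, θ k • EuclideanSpace.single k 1) := by
    intro i
    rw [map_sub, ← hout, map_smul, hY]
  simpa only [hdir, Finset.sum_add_distrib, hsum, add_zero] using htangent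
end

section
/- Let Φ : ℝ^D → [0,∞) be differentiable with ∇Φ Lipschitz with constant L > 0. Let c̲, c̄ > 0 and let (θ^t)_{t≥0} in ℝ^D satisfy θ^{t+1} = θ^t − α^t·g^t where the vectors g^t ∈ ℝ^D satisfy c̲·‖∇Φ(θ^t)‖² ≤ ⟨∇Φ(θ^t), g^t⟩ and ‖g^t‖² ≤ c̄·‖∇Φ(θ^t)‖² for all t ≥ 0. If α^t ≥ 0 for all t, α^t → 0 as t → ∞, and Σ_{t=0}^∞ α^t = ∞, then ∇Φ(θ^t) → 0 as t → ∞. (Intermediate claim, case (ii), in the proof of Theorem 3.) -/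
open Filter
open scoped RealInnerProductSpace

/-- A descent inequality for functions with Lipschitz gradient. -/
lemma le_add_inner_gradient_add_sq {E : Type*} [NormedAddCommGroup E] [InnerProductSpace ℝ E]
    [CompleteSpace E] {f : E → ℝ} {L : ℝ} (hL : 0 ≤ L) (hdiff : Differentiable ℝ f)
    (hlip : ∀ a b, ‖gradient f a - gradient f b‖ ≤ L * ‖a - b‖) (x y : E) :
    f y ≤ f x + ⟪gradient f x, y - x⟫ + L * ‖y - x‖ ^ 2 := by
  obtain ⟨z, hz, h⟩ := domain_mvt (f := f) (s := Set.univ) (x := x) (y := y)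
    (fun w _ => (hdiff w).hasGradientAt.hasFDerivAt.hasFDerivWithinAt)
    convex_univ (Set.mem_univ x) (Set.mem_univ y)
  rw [InnerProductSpace.toDual_apply_apply] at h
  have hzx : ‖z - x‖ ≤ ‖y - x‖ := by
    rw [segment_eq_image'] at hz
    obtain ⟨t, ⟨ht0, ht1⟩, rfl⟩ := hz
    rw [add_sub_cancel_left, norm_smul, Real.norm_of_nonneg ht0]
    exact mul_le_of_le_one_left (norm_nonneg _) ht1
  have hinner : ⟪gradient f z - gradient f x, y - x⟫ ≤ L * ‖y - x‖ ^ 2 :=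
    calc ⟪gradient f z - gradient f x, y - x⟫
        ≤ ‖gradient f z - gradient f x‖ * ‖y - x‖ := real_inner_le_norm _ _
      _ ≤ L * ‖y - x‖ * ‖y - x‖ := by
        gcongr
        exact (hlip z x).trans (by gcongr)
      _ = L * ‖y - x‖ ^ 2 := by ring
  rw [inner_sub_left] at hinner
  linarith

/-- A sequence whose decrements eventually dominate `c * a` while it stays nonnegative forces the
nonnegative sequence `a` to be summable. -/
lemma summable_of_eventually_mul_le_sub_succ {a F : ℕ → ℝ} {c : ℝ} (hc : 0 < c)
    (ha : ∀ t, 0 ≤ a t) (hF : ∀ t, 0 ≤ F t)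
    (h : ∀ᶠ t in atTop, c * a t ≤ F t - F (t + 1)) : Summable a := by
  obtain ⟨N, hN⟩ := eventually_atTop.1 h
  rw [← summable_nat_add_iff N]
  refine summable_of_sum_range_le (c := F N / c) (fun t => ha _) fun n => ?_
  have hsum : c * ∑ t ∈ Finset.range n, a (t + N) ≤ F N - F (n + N) := by
    induction n with
    | zero => simp
    | succ n ih =>
      rw [Finset.sum_range_succ, mul_add]
      have hn := hN (n + N) (Nat.le_add_left _ _)
      rw [Nat.add_right_comm n 1 N]
      linarith
  rw [le_div_iff₀ hc]
  linarith [hF (n + N)]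

/-- If `∑ α` diverges, `∑ α * H` converges and the increments of `H` are dominated by `α * H`,
then `H` tends to zero. -/
lemma tendsto_zero_of_summable_mul_of_dist_succ_le {α H : ℕ → ℝ} {C : ℝ}
    (hα : ∀ t, 0 ≤ α t) (hH : ∀ t, 0 ≤ H t) (hdiv : ¬ Summable α)
    (hsum : Summable fun t => α t * H t)
    (hstep : ∀ t, dist (H t) (H (t + 1)) ≤ C * (α t * H t)) : Tendsto H atTop (nhds 0) := by
  obtain ⟨l, hl⟩ := cauchySeq_tendsto_of_complete
    (cauchySeq_of_dist_le_of_summable _ hstep (hsum.mul_left C))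
  have hl0 : 0 ≤ l := ge_of_tendsto' hl hH
  rcases hl0.eq_or_lt with rfl | hpos
  · exact hl
  refine absurd ?_ hdiv
  refine Summable.of_norm_bounded_eventually_nat (hsum.mul_left (2 / l)) ?_
  filter_upwards [hl.eventually (lt_mem_nhds (half_lt_self hpos))] with t ht
  rw [Real.norm_of_nonneg (hα t)]
  calc α t = 2 / l * (α t * (l / 2)) := by field_simp
    _ ≤ 2 / l * (α t * H t) := by
      have := hα t
      gcongr

/-- Intermediate claim, case (ii), in the proof of Theorem 3: with nonnegative stepsizes tending
to zero whose series diverges, the gradients along the iterates converge to zero. -/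
theorem stmt_5 (D : ℕ)
    (Φ : EuclideanSpace ℝ (Fin D) → ℝ)
    (hΦnn : ∀ p, 0 ≤ Φ p)
    (L : ℝ) (hL : 0 < L)
    (hdiff : Differentiable ℝ Φ)
    (hlip : ∀ a b, ‖gradient Φ a - gradient Φ b‖ ≤ L * ‖a - b‖)
    (cl cu : ℝ) (hcl : 0 < cl) (hcu : 0 < cu)
    (θ g : ℕ → EuclideanSpace ℝ (Fin D)) (α : ℕ → ℝ)
    (hupd : ∀ t, θ (t + 1) = θ t - α t • g t)
    (hg1 : ∀ t, cl * ‖gradient Φ (θ t)‖ ^ 2 ≤ ⟪gradient Φ (θ t), g t⟫)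
    (hg2 : ∀ t, ‖g t‖ ^ 2 ≤ cu * ‖gradient Φ (θ t)‖ ^ 2)
    (hα0 : ∀ t, 0 ≤ α t)
    (hαlim : Tendsto α atTop (nhds 0))
    (hαdiv : Tendsto (fun N => ∑ t ∈ Finset.range N, α t) atTop atTop) :
    Tendsto (fun t => gradient Φ (θ t)) atTop (nhds 0) := by
  have hgn : ∀ t, ‖g t‖ ≤ √cu * ‖gradient Φ (θ t)‖ := fun t => by
    refine abs_le_of_sq_le_sq' ?_ (by positivity) |>.2
    rw [mul_pow, Real.sq_sqrt hcu.le]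
    exact hg2 t
  have hsub : ∀ t, θ (t + 1) - θ t = -(α t • g t) := fun t => by rw [hupd t]; abel
  have hsum : Summable fun t => α t * ‖gradient Φ (θ t)‖ ^ 2 := by
    refine summable_of_eventually_mul_le_sub_succ (F := fun t => Φ (θ t)) (half_pos hcl)
      (fun t => mul_nonneg (hα0 t) (sq_nonneg _)) (fun t => hΦnn _) ?_
    have hpos : 0 < cl / 2 / (L * cu) := by positivity
    filter_upwards [hαlim.eventually (gt_mem_nhds hpos)] with t ht
    have hdesc := le_add_inner_gradient_add_sq hL.le hdiff hlip (θ t) (θ (t + 1))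
    rw [hsub, inner_neg_right, real_inner_smul_right, norm_neg, norm_smul, mul_pow,
      Real.norm_of_nonneg (hα0 t)] at hdesc
    rw [lt_div_iff₀ (by positivity)] at ht
    have h1 := mul_le_mul_of_nonneg_left (hg1 t) (hα0 t)
    have h2 : L * (α t ^ 2 * ‖g t‖ ^ 2) ≤ L * (α t ^ 2 * (cu * ‖gradient Φ (θ t)‖ ^ 2)) := by
      gcongr
      exact hg2 t
    have h3 := mul_le_mul_of_nonneg_right ht.le
      (mul_nonneg (hα0 t) (sq_nonneg ‖gradient Φ (θ t)‖))
    linarith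
  obtain ⟨M, hM⟩ := hαlim.bddAbove_range
  have hstep : ∀ t, dist (‖gradient Φ (θ t)‖ ^ 2) (‖gradient Φ (θ (t + 1))‖ ^ 2)
      ≤ (L * √cu * (2 + L * √cu * M)) * (α t * ‖gradient Φ (θ t)‖ ^ 2) := fun t => by
    have hαM : α t ≤ M := hM ⟨t, rfl⟩
    have hα := hα0 t
    set u := ‖gradient Φ (θ t)‖
    set v := ‖gradient Φ (θ (t + 1))‖
    have hu0 : 0 ≤ u := norm_nonneg _
    have hv0 : 0 ≤ v := norm_nonneg _
    have huv : |v - u| ≤ L * √cu * α t * u :=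
      calc |v - u| ≤ ‖gradient Φ (θ (t + 1)) - gradient Φ (θ t)‖ := abs_norm_sub_norm_le _ _
        _ ≤ L * ‖θ (t + 1) - θ t‖ := hlip _ _
        _ = L * (α t * ‖g t‖) := by
          rw [hsub, norm_neg, norm_smul, Real.norm_of_nonneg hα]
        _ ≤ L * (α t * (√cu * u)) := by
          gcongr
          exact hgn t
        _ = L * √cu * α t * u := by ring
    have hadd : v + u ≤ (2 + L * √cu * M) * u := by
      have : L * √cu * α t * u ≤ L * √cu * M * u := by gcongr
      linarith [le_abs_self (v - u)]
    calc dist (u ^ 2) (v ^ 2) = |v - u| * (v + u) := by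
          rw [dist_comm, Real.dist_eq, sq_sub_sq, abs_mul, abs_of_nonneg (add_nonneg hv0 hu0),
            mul_comm]
      _ ≤ (L * √cu * α t * u) * ((2 + L * √cu * M) * u) := by gcongr
      _ = (L * √cu * (2 + L * √cu * M)) * (α t * u ^ 2) := by ring
  have hdiv : ¬ Summable α := (not_summable_iff_tendsto_nat_atTop_of_nonneg hα0).2 hαdiv
  have hsq := tendsto_zero_of_summable_mul_of_dist_succ_le hα0 (fun t => sq_nonneg _) hdiv
    hsum hstep
  rw [tendsto_zero_iff_norm_tendsto_zero]
  simpa [Real.sqrt_sq] using hsq.sqrt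
end

section
/- Assume: the common model structure assumption; each ℓ_i is differentiable and convex; each map θ ↦ f(x_i,θ) is differentiable on ℝ^d; ∇L is Lipschitz with constant L_c > 0. Let c̲, c̄ > 0 and let (θ^t)_{t≥0} satisfy θ^{t+1} = θ^t − α^t·g^t with c̲·‖∇L(θ^t)‖² ≤ ⟨∇L(θ^t), g^t⟩ and ‖g^t‖² ≤ c̄·‖∇L(θ^t)‖² for all t, where the stepsizes satisfy either (i) there is ε > 0 with ε ≤ α^t ≤ c̲·(2−ε)/(L_c·c̄) for all t, or (ii) α^t ≥ 0, α^t → 0 and Σ_t α^t = ∞. Let Y* ∈ ℝ^{n×m_y} and τ ≥ 0 be such that vec(Y*) ∈ Col(J(θ^t)) for all t ≥ τ. Then every limit point θ̂ of the sequence (θ^t) at which the alignment condition vec(Y*) ∈ Col(J(θ̂)) also holds satisfies L(θ̂) ≤ L*(η·Y*) for every η ∈ ℝ. (Theorem 3; the alignment hypothesis at the limit point is included to make the statement precise.) -/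
open Filter
open scoped RealInnerProductSpace

section GradientDescent

variable {F : Type*} [NormedAddCommGroup F]

/-- First-order characterization of convexity. -/
theorem ConvexOn.add_hasFDerivAt_le [NormedSpace ℝ F] {h : F → ℝ} (hc : ConvexOn ℝ Set.univ h)
    {p : F} {h' : F →L[ℝ] ℝ} (hd : HasFDerivAt h h' p) (q : F) : h p + h' (q - p) ≤ h q := by
  have hline : HasDerivAt (h ∘ AffineMap.lineMap (k := ℝ) p q) (h' (q - p)) 0 := by
    refine HasFDerivAt.comp_hasDerivAt (0 : ℝ) ?_ AffineMap.hasDerivAt_lineMap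
    simpa using hd
  have hconv : ConvexOn ℝ Set.univ (h ∘ AffineMap.lineMap (k := ℝ) p q) :=
    hc.comp_affineMap (AffineMap.lineMap (k := ℝ) p q)
  have := hconv.le_slope_of_hasDerivAt (Set.mem_univ 0) (Set.mem_univ 1) one_pos hline
  simp only [slope_def_field, Function.comp_apply, AffineMap.lineMap_apply_one,
    AffineMap.lineMap_apply_zero, sub_zero, div_one] at this
  linarith

variable [InnerProductSpace ℝ F] [CompleteSpace F]

/-- The descent lemma for a function with Lipschitz gradient. -/
theorem le_add_inner_gradient_add_sq_s6 {L : F → ℝ} (hL : Differentiable ℝ L) {K : ℝ}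
    (hlip : ∀ a b, ‖gradient L a - gradient L b‖ ≤ K * ‖a - b‖) (p v : F) :
    L (p + v) ≤ L p + ⟪gradient L p, v⟫ + K / 2 * ‖v‖ ^ 2 := by
  have hder : ∀ s : ℝ, HasDerivAt
      (fun s : ℝ => L (p + s • v) - s * ⟪gradient L p, v⟫ - K / 2 * ‖v‖ ^ 2 * s ^ 2)
      (⟪gradient L (p + s • v), v⟫ - ⟪gradient L p, v⟫ - K / 2 * ‖v‖ ^ 2 * (2 * s)) s := by
    intro s
    have hcurve : HasDerivAt (fun s : ℝ => p + s • v) v s := by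
      simpa using ((hasDerivAt_id s).smul_const v).const_add p
    have h₁ : HasDerivAt (fun s : ℝ => L (p + s • v)) ⟪gradient L (p + s • v), v⟫ s := by
      rw [← InnerProductSpace.toDual_apply_apply (𝕜 := ℝ), toDual_gradient]
      exact (hL (p + s • v)).hasFDerivAt.comp_hasDerivAt s hcurve
    have h₂ : HasDerivAt (fun s : ℝ => s * ⟪gradient L p, v⟫) ⟪gradient L p, v⟫ s := by
      simpa using (hasDerivAt_id s).mul_const ⟪gradient L p, v⟫
    have h₃ : HasDerivAt (fun s : ℝ => K / 2 * ‖v‖ ^ 2 * s ^ 2) (K / 2 * ‖v‖ ^ 2 * (2 * s)) s := by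
      simpa using (hasDerivAt_pow 2 s).const_mul (K / 2 * ‖v‖ ^ 2)
    exact (h₁.sub h₂).sub h₃
  have hanti := antitoneOn_of_deriv_nonpos (convex_Ici (0 : ℝ))
    (fun s _ => (hder s).continuousAt.continuousWithinAt)
    (fun s _ => (hder s).differentiableAt.differentiableWithinAt) (by
      intro s hs
      have hs : 0 < s := by simpa using hs
      rw [(hder s).deriv, ← inner_sub_left]
      have h₁ := real_inner_le_norm (gradient L (p + s • v) - gradient L p) v
      have h₂ := hlip (p + s • v) p
      rw [add_sub_cancel_left, norm_smul, Real.norm_of_nonneg hs.le] at h₂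
      nlinarith [mul_le_mul_of_nonneg_right h₂ (norm_nonneg v)])
  have := hanti (Set.self_mem_Ici (a := (0 : ℝ))) (Set.mem_Ici.2 zero_le_one) zero_le_one
  simp only [one_smul, zero_smul, add_zero, one_mul, zero_mul, one_pow, mul_one, sub_zero, ne_eq,
    OfNat.ofNat_ne_zero, not_false_eq_true, zero_pow, mul_zero] at this
  linarith

/-- One step along a gradient-related direction decreases the objective. -/
theorem le_sub_of_gradient_related {L : F → ℝ} (hL : Differentiable ℝ L) {K : ℝ} (hK : 0 ≤ K)
    (hlip : ∀ a b, ‖gradient L a - gradient L b‖ ≤ K * ‖a - b‖) {cl cu a : ℝ} (ha : 0 ≤ a)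
    {p g : F} (hg₁ : cl * ‖gradient L p‖ ^ 2 ≤ ⟪gradient L p, g⟫)
    (hg₂ : ‖g‖ ^ 2 ≤ cu * ‖gradient L p‖ ^ 2) :
    L (p - a • g) ≤ L p - (cl - K * cu * a / 2) * (a * ‖gradient L p‖ ^ 2) := by
  have h := le_add_inner_gradient_add_sq_s6 hL hlip p (-(a • g))
  rw [← sub_eq_add_neg, inner_neg_right, inner_smul_right, norm_neg, norm_smul,
    Real.norm_of_nonneg ha, mul_pow] at h
  have h₁ := mul_le_mul_of_nonneg_left hg₁ ha
  have h₂ := mul_le_mul_of_nonneg_left hg₂ (by positivity : 0 ≤ K / 2 * a ^ 2)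
  linarith

/-- If a nonnegative sequence has relative increments controlled by non-summable bounded weights
`α`, and its square is summable against `α`, then it tends to zero. -/
theorem tendsto_zero_of_summable_mul_sq {a α : ℕ → ℝ} {A C : ℝ} (ha : ∀ t, 0 ≤ a t)
    (hα : ∀ t, 0 ≤ α t) (hA : ∀ t, α t ≤ A) (hC : 0 ≤ C)
    (hinc : ∀ t, |a (t + 1) - a t| ≤ C * α t * a t) (hns : ¬ Summable α)
    (hs : Summable fun t => α t * a t ^ 2) : Tendsto a atTop (nhds 0) := by
  have hcauchy : CauchySeq fun t => a t ^ 2 := by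
    refine cauchySeq_of_dist_le_of_summable (fun t => C * (2 + C * A) * (α t * a t ^ 2)) ?_
      (hs.mul_left _)
    intro t
    have hsum : a (t + 1) + a t ≤ (2 + C * A) * a t := by
      have h₁ := (abs_le.1 (hinc t)).2
      have h₂ := mul_le_mul_of_nonneg_right (mul_le_mul_of_nonneg_left (hA t) hC) (ha t)
      linarith
    have hpos : 0 ≤ a (t + 1) + a t := add_nonneg (ha _) (ha _)
    have hcoef : 0 ≤ C * α t * a t := mul_nonneg (mul_nonneg hC (hα t)) (ha t)
    rw [dist_comm, Real.dist_eq, Nat.succ_eq_add_one,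
      show a (t + 1) ^ 2 - a t ^ 2 = (a (t + 1) - a t) * (a (t + 1) + a t) by ring, abs_mul,
      abs_of_nonneg hpos]
    calc |a (t + 1) - a t| * (a (t + 1) + a t)
        ≤ C * α t * a t * ((2 + C * A) * a t) := mul_le_mul (hinc t) hsum hpos hcoef
      _ = C * (2 + C * A) * (α t * a t ^ 2) := by ring
  obtain ⟨b, hb⟩ := cauchySeq_tendsto_of_complete hcauchy
  have hb_nonneg : 0 ≤ b := ge_of_tendsto' hb fun t => sq_nonneg _
  have hb_zero : b = 0 := by
    by_contra hne
    have hb_pos : 0 < b := lt_of_le_of_ne hb_nonneg (Ne.symm hne)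
    obtain ⟨T, hT⟩ := eventually_atTop.1 (hb.eventually (eventually_gt_nhds (half_lt_self hb_pos)))
    refine hns ((summable_nat_add_iff T).1 ?_)
    refine Summable.of_nonneg_of_le (fun t => hα _) (fun t => ?_)
      (((summable_nat_add_iff T).2 hs).mul_left (2 / b))
    have h₁ := mul_le_mul_of_nonneg_left (hT (t + T) (Nat.le_add_left _ _)).le (hα (t + T))
    calc α (t + T) = 2 / b * (α (t + T) * (b / 2)) := by field_simp
      _ ≤ 2 / b * (α (t + T) * a (t + T) ^ 2) :=
        mul_le_mul_of_nonneg_left h₁ (by positivity)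
  have hsqrt := (hb_zero ▸ hb).sqrt
  simpa [Real.sqrt_sq (ha _)] using hsqrt

/-- Gradients vanish asymptotically along gradient-related iterations whose stepsizes are
nonnegative, bounded, non-summable and small enough to ensure descent. -/
theorem tendsto_gradient_zero_of_gradient_related {L : F → ℝ} (hL : Differentiable ℝ L)
    (hL_nonneg : ∀ p, 0 ≤ L p) {K : ℝ} (hK : 0 ≤ K)
    (hlip : ∀ a b, ‖gradient L a - gradient L b‖ ≤ K * ‖a - b‖) {cl cu A c : ℝ}
    {θ g : ℕ → F} {α : ℕ → ℝ} (hupd : ∀ t, θ (t + 1) = θ t - α t • g t)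
    (hg₁ : ∀ t, cl * ‖gradient L (θ t)‖ ^ 2 ≤ ⟪gradient L (θ t), g t⟫)
    (hg₂ : ∀ t, ‖g t‖ ^ 2 ≤ cu * ‖gradient L (θ t)‖ ^ 2)
    (hα : ∀ t, 0 ≤ α t) (hA : ∀ t, α t ≤ A) (hns : ¬ Summable α) (hc : 0 < c)
    (hsmall : ∀ t, c ≤ cl - K * cu * α t / 2) :
    Tendsto (fun t => gradient L (θ t)) atTop (nhds 0) := by
  rw [tendsto_zero_iff_norm_tendsto_zero]
  refine tendsto_zero_of_summable_mul_sq (α := α) (C := K * √cu) (fun t => norm_nonneg _) hα hA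
    (by positivity) (fun t => ?_) hns ?_
  · have hg : ‖g t‖ ≤ √cu * ‖gradient L (θ t)‖ := by
      have := Real.sqrt_le_sqrt (hg₂ t)
      rwa [Real.sqrt_sq (norm_nonneg _), Real.sqrt_mul' _ (sq_nonneg _),
        Real.sqrt_sq (norm_nonneg _)] at this
    calc |‖gradient L (θ (t + 1))‖ - ‖gradient L (θ t)‖|
        ≤ ‖gradient L (θ (t + 1)) - gradient L (θ t)‖ := abs_norm_sub_norm_le _ _
      _ ≤ K * ‖θ (t + 1) - θ t‖ := hlip _ _
      _ = K * (α t * ‖g t‖) := by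
        rw [hupd, sub_sub_cancel_left, norm_neg, norm_smul, Real.norm_of_nonneg (hα t)]
      _ ≤ K * (α t * (√cu * ‖gradient L (θ t)‖)) := by have := hα t; gcongr
      _ = K * √cu * α t * ‖gradient L (θ t)‖ := by ring
  · refine summable_of_sum_range_le (c := L (θ 0) / c)
      (fun t => mul_nonneg (hα t) (sq_nonneg _)) fun N => ?_
    have hsum : c * ∑ t ∈ Finset.range N, α t * ‖gradient L (θ t)‖ ^ 2 ≤ L (θ 0) - L (θ N) := by
      rw [Finset.mul_sum, ← Finset.sum_range_sub' (fun t => L (θ t))]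
      refine Finset.sum_le_sum fun t _ => ?_
      have h₁ := le_sub_of_gradient_related hL hK hlip (hα t) (hg₁ t) (hg₂ t)
      have h₂ := mul_le_mul_of_nonneg_right (hsmall t)
        (mul_nonneg (hα t) (sq_nonneg ‖gradient L (θ t)‖))
      rw [← hupd] at h₁
      linarith
    rw [le_div_iff₀ hc]
    linarith [hL_nonneg (θ N)]

end GradientDescent

/-- Theorem 3: under the common model structure assumption, differentiable convex losses,
differentiable model, Lipschitz gradient of the objective, and the stated stepsize conditions,
if the data-architecture alignment condition `vec(Y*) ∈ Col(J(θ^t))` holds for all `t ≥ τ`,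
then every limit point `θ̂` of the iterates at which the alignment condition also holds
satisfies `L(θ̂) ≤ L*(η Y*)` for every `η ∈ ℝ`. -/
theorem stmt_6
    (n mx my d : ℕ) (hn : 0 < n)
    (x : Fin n → EuclideanSpace ℝ (Fin mx))
    (y : Fin n → EuclideanSpace ℝ (Fin my))
    (f : EuclideanSpace ℝ (Fin mx) → EuclideanSpace ℝ (Fin d) → EuclideanSpace ℝ (Fin my))
    (fX : EuclideanSpace ℝ (Fin d) → Fin n → EuclideanSpace ℝ (Fin my))
    (hfX : ∀ θ' i, fX θ' i = f (x i) θ')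
    (ℓ : EuclideanSpace ℝ (Fin my) → EuclideanSpace ℝ (Fin my) → ℝ)
    (hℓnn : ∀ p q, 0 ≤ ℓ p q)
    -- common model structure assumption
    (S : Finset (Fin d))
    (hCMS : ∀ (i : Fin n) (θ' : EuclideanSpace ℝ (Fin d)),
      f (x i) θ' = ∑ k ∈ S, θ' k • fderiv ℝ (f (x i)) θ' (EuclideanSpace.single k 1))
    -- each ℓ_i is differentiable and convex, each f_i is differentiable
    (hℓdiff : ∀ i, Differentiable ℝ (fun q => ℓ q (y i)))
    (hℓconv : ∀ i, ConvexOn ℝ Set.univ (fun q => ℓ q (y i)))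
    (hfdiff : ∀ i, Differentiable ℝ (f (x i)))
    (L : EuclideanSpace ℝ (Fin d) → ℝ)
    (hL : ∀ θ', L θ' = (1 / (n : ℝ)) * ∑ i, ℓ (f (x i) θ') (y i))
    -- ∇L is Lipschitz with constant Lc > 0
    (Lc : ℝ) (hLc : 0 < Lc)
    (hlip : ∀ a b, ‖gradient L a - gradient L b‖ ≤ Lc * ‖a - b‖)
    -- the training dynamics
    (cl cu : ℝ) (hcl : 0 < cl) (hcu : 0 < cu)
    (θ g : ℕ → EuclideanSpace ℝ (Fin d)) (α : ℕ → ℝ)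
    (hupd : ∀ t, θ (t + 1) = θ t - α t • g t)
    (hg1 : ∀ t, cl * ‖gradient L (θ t)‖ ^ 2 ≤ ⟪gradient L (θ t), g t⟫)
    (hg2 : ∀ t, ‖g t‖ ^ 2 ≤ cu * ‖gradient L (θ t)‖ ^ 2)
    -- stepsize condition (i) or (ii)
    (hstep :
      (∃ ε > (0 : ℝ), ∀ t, ε ≤ α t ∧ α t ≤ cl * (2 - ε) / (Lc * cu)) ∨
      ((∀ t, 0 ≤ α t) ∧ Tendsto α atTop (nhds 0) ∧
        Tendsto (fun N => ∑ t ∈ Finset.range N, α t) atTop atTop))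
    -- data-architecture alignment condition along the trajectory from time τ on
    (Y : Fin n → EuclideanSpace ℝ (Fin my)) (τ : ℕ)
    (halign : ∀ t, τ ≤ t → Y ∈ Set.range (fderiv ℝ fX (θ t)))
    -- a limit point of the sequence at which the alignment condition also holds
    (θhat : EuclideanSpace ℝ (Fin d))
    (hlimit : ∃ φ : ℕ → ℕ, StrictMono φ ∧ Tendsto (fun m => θ (φ m)) atTop (nhds θhat))
    (halignhat : Y ∈ Set.range (fderiv ℝ fX θhat)) :
    ∀ η : ℝ, L θhat ≤ (1 / (n : ℝ)) * ∑ i, ℓ (η • Y i) (y i) := by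
  intro η
  have hn' : (0 : ℝ) < n := by exact_mod_cast hn
  have hLfd : ∀ p, HasFDerivAt L ((1 / (n : ℝ)) • ∑ i,
      (fderiv ℝ (fun q => ℓ q (y i)) (f (x i) p)).comp (fderiv ℝ (f (x i)) p)) p := by
    intro p
    have hL_eq : L = fun p => (1 / (n : ℝ)) • ∑ i, ℓ (f (x i) p) (y i) := by
      funext p
      rw [hL, smul_eq_mul]
    rw [hL_eq]
    have hsum := HasFDerivAt.fun_sum (u := Finset.univ) fun i _ =>
      (hℓdiff i (f (x i) p)).hasFDerivAt.comp p (hfdiff i p).hasFDerivAt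
    exact hsum.const_smul (1 / (n : ℝ))
  have hLdiff : Differentiable ℝ L := fun p => (hLfd p).differentiableAt
  have hL_nonneg : ∀ p, 0 ≤ L p := fun p => by
    rw [hL]
    exact mul_nonneg (by positivity) (Finset.sum_nonneg fun i _ => hℓnn _ _)
  have hgrad : Tendsto (fun t => gradient L (θ t)) atTop (nhds 0) := by
    rcases hstep with ⟨ε, hε, hα⟩ | ⟨hα, hα_zero, hα_sum⟩
    · refine tendsto_gradient_zero_of_gradient_related hLdiff hL_nonneg hLc.le hlip hupd hg1 hg2
        (fun t => hε.le.trans (hα t).1) (fun t => (hα t).2) (fun hs => ?_)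
        (c := cl * ε / 2) (by positivity) fun t => ?_
      · exact hε.not_ge (ge_of_tendsto' hs.tendsto_atTop_zero fun t => (hα t).1)
      · have := (le_div_iff₀ (mul_pos hLc hcu)).1 (hα t).2
        linarith
    · obtain ⟨T, hT⟩ := eventually_atTop.1 (hα_zero.eventually
        (eventually_lt_nhds (by positivity : 0 < cl / (Lc * cu))))
      rw [← tendsto_add_atTop_iff_nat T]
      refine tendsto_gradient_zero_of_gradient_related hLdiff hL_nonneg hLc.le hlip
        (θ := fun t => θ (t + T)) (α := fun t => α (t + T)) (g := fun t => g (t + T))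
        (fun t => by simp only [add_right_comm t 1 T, hupd])
        (fun t => hg1 _) (fun t => hg2 _)
        (fun t => hα _) (fun t => (hT _ (Nat.le_add_left _ _)).le) (fun hs => ?_)
        (c := cl / 2) (by positivity) fun t => ?_
      · exact (not_summable_iff_tendsto_nat_atTop_of_nonneg hα).2 hα_sum
          ((summable_nat_add_iff T).1 hs)
      · have := (lt_div_iff₀ (mul_pos hLc hcu)).1 (hT (t + T) (Nat.le_add_left _ _))
        linarith
  have hstat : gradient L θhat = 0 := by
    obtain ⟨φ, hφ, hφ_lim⟩ := hlimit
    have hcont : Continuous (gradient L) :=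
      (LipschitzWith.of_dist_le_mul (K := Lc.toNNReal) fun a b => by
        simpa only [dist_eq_norm, Real.coe_toNNReal _ hLc.le] using hlip a b).continuous
    exact tendsto_nhds_unique ((hcont.tendsto θhat).comp hφ_lim) (hgrad.comp hφ.tendsto_atTop)
  have hfd_zero : fderiv ℝ L θhat = 0 := by rw [← toDual_gradient, hstat, map_zero]
  obtain ⟨v, hv⟩ := halignhat
  have hY : ∀ i, Y i = fderiv ℝ (f (x i)) θhat v := by
    intro i
    have hfX_eq : fX = fun p i => f (x i) p := funext fun p => funext fun i => hfX p i
    rw [← hv, hfX_eq, fderiv_pi fun i => hfdiff i θhat]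
    rfl
  have hout : ∀ i, η • Y i - f (x i) θhat = fderiv ℝ (f (x i)) θhat
      (η • v - ∑ k ∈ S, θhat k • EuclideanSpace.single k 1) := by
    intro i
    simp only [map_sub, map_smul, map_sum]
    rw [← hY, ← hCMS]
  have hsum_zero : (1 / (n : ℝ)) * ∑ i, fderiv ℝ (fun q => ℓ q (y i)) (f (x i) θhat)
      (η • Y i - f (x i) θhat) = 0 := by
    have h := congrArg (fun D => D (η • v - ∑ k ∈ S, θhat k • EuclideanSpace.single k 1))
      ((hLfd θhat).fderiv.symm.trans hfd_zero)
    simp only [smul_apply, sum_apply,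
      ContinuousLinearMap.comp_apply, zero_apply, smul_eq_mul] at h
    simpa only [hout] using h
  rw [hL, ← add_zero (_ * _), ← hsum_zero, ← mul_add, ← Finset.sum_add_distrib]
  refine mul_le_mul_of_nonneg_left (Finset.sum_le_sum fun i _ => ?_) (by positivity)
  exact (hℓconv i).add_hasFDerivAt_le (hℓdiff i _).hasFDerivAt _
end

section
/- Assume the common model structure assumption, that each ℓ_i is differentiable and convex, that each map θ ↦ f(x_i,θ) is differentiable on ℝ^d, and that ∇L is Lipschitz with constant L_c > 0. Let α ∈ (0,1) and define θ^{t+1} = θ^t − (2α/L_c)·∇L(θ^t) for t ≥ 0. Let T ⊆ ℕ be nonempty and finite with t_0 = min T, let Y* ∈ ℝ^{n×m_y} and η ∈ ℝ, and suppose that for each t ∈ T there is a vector β^t ∈ ℝ^d with J(θ^t)·β^t = η·vec(Y*). Then min_{t∈T} L(θ^t) ≤ L*(η·Y*) + (1/√|T|)·√( L_c·ζ·L(θ^{t_0}) / (2α(1−α)) ), where ζ = 4·max_{t∈T} max(‖ν(θ^t)‖², ‖β^t‖²). (Theorem 4; the paper's hypothesis vec(Y*) ∈ Col(J(θ^t))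 with β^t the least-squares solution via the Moore–Penrose pseudoinverse is the special case.) -/
open scoped RealInnerProductSpace

/-- The tangent inequality for a differentiable convex function on a real normed space. -/
theorem ConvexOn.add_fderiv_le {E : Type*} [NormedAddCommGroup E] [NormedSpace ℝ E]
    {g : E → ℝ} (hg : ConvexOn ℝ Set.univ g) {p : E} (hd : DifferentiableAt ℝ g p) (q : E) :
    g p + fderiv ℝ g p (q - p) ≤ g q := by
  have hline : HasDerivAt (AffineMap.lineMap p q : ℝ → E) (q - p) 0 :=
    AffineMap.hasDerivAt_lineMap
  have hderiv : HasDerivAt (g ∘ AffineMap.lineMap p q) (fderiv ℝ g p (q - p)) (0 : ℝ) := by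
    refine HasFDerivAt.comp_hasDerivAt (0 : ℝ) ?_ hline
    simpa using hd.hasFDerivAt
  have hconv : ConvexOn ℝ Set.univ (g ∘ (AffineMap.lineMap p q : ℝ →ᵃ[ℝ] E)) := by
    simpa using hg.comp_affineMap (AffineMap.lineMap p q : ℝ →ᵃ[ℝ] E)
  have h := hconv.le_slope_of_hasDerivAt (Set.mem_univ 0) (Set.mem_univ 1) one_pos hderiv
  simp only [slope_def_field, Function.comp_apply, AffineMap.lineMap_apply_one,
    AffineMap.lineMap_apply_zero, sub_zero, div_one] at h
  linarith

/-- The descent lemma: a differentiable function with `K`-Lipschitz gradient lies below its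
quadratic upper model. -/
theorem le_add_inner_gradient_add_sq_of_lipschitz {E : Type*} [NormedAddCommGroup E]
    [InnerProductSpace ℝ E] [CompleteSpace E] {g : E → ℝ} (hg : Differentiable ℝ g) {K : ℝ}
    (hlip : ∀ a b, ‖gradient g a - gradient g b‖ ≤ K * ‖a - b‖) (a v : E) :
    g (a + v) ≤ g a + ⟪gradient g a, v⟫ + K / 2 * ‖v‖ ^ 2 := by
  have hpath (s : ℝ) : HasDerivAt (fun s : ℝ => g (a + s • v)) ⟪gradient g (a + s • v), v⟫ s := by
    have h := (hg (a + s • v)).hasFDerivAt.comp_hasDerivAt s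
      (((hasDerivAt_id s).smul_const v).const_add a)
    simpa [inner_gradient_left, Function.comp_def] using h
  have hmodel (s : ℝ) : HasDerivAt
      (fun s : ℝ => g a + s * ⟪gradient g a, v⟫ + K / 2 * ‖v‖ ^ 2 * s ^ 2)
      (⟪gradient g a, v⟫ + K * ‖v‖ ^ 2 * s) s := by
    have h := (((hasDerivAt_id s).mul_const ⟪gradient g a, v⟫).const_add (g a)).add
      ((hasDerivAt_pow 2 s).const_mul (K / 2 * ‖v‖ ^ 2))
    refine h.congr_deriv ?_
    simp only [Nat.cast_ofNat, Nat.add_one_sub_one, pow_one]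
    ring
  have h := image_le_of_deriv_right_le_deriv_boundary (a := 0) (b := 1)
    (fun s _ => (hpath s).continuousAt.continuousWithinAt)
    (fun s _ => (hpath s).hasDerivWithinAt) (by simp)
    (fun s _ => (hmodel s).continuousAt.continuousWithinAt)
    (fun s _ => (hmodel s).hasDerivWithinAt)
    (fun s hs => by
      have hinner : ⟪gradient g (a + s • v) - gradient g a, v⟫ ≤ K * ‖v‖ ^ 2 * s :=
        calc ⟪gradient g (a + s • v) - gradient g a, v⟫
            ≤ ‖gradient g (a + s • v) - gradient g a‖ * ‖v‖ := real_inner_le_norm _ _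
          _ ≤ K * ‖a + s • v - a‖ * ‖v‖ := by gcongr; exact hlip _ _
          _ = K * ‖v‖ ^ 2 * s := by
            rw [add_sub_cancel_left, norm_smul, Real.norm_of_nonneg hs.1]; ring
      rw [inner_sub_left] at hinner
      linarith)
    (Set.right_mem_Icc.2 zero_le_one)
  simpa using h

/-- The decrease of the objective along one gradient step of size `2α/K`. -/
theorem gradient_step_decrease {E : Type*} [NormedAddCommGroup E]
    [InnerProductSpace ℝ E] [CompleteSpace E] {g : E → ℝ} (hg : Differentiable ℝ g) {K : ℝ}
    (hK : 0 < K) (hlip : ∀ a b, ‖gradient g a - gradient g b‖ ≤ K * ‖a - b‖) (α : ℝ) (a : E) :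
    2 * α * (1 - α) / K * ‖gradient g a‖ ^ 2 ≤
      g a - g (a - (2 * α / K) • gradient g a) := by
  have h := le_add_inner_gradient_add_sq_of_lipschitz hg hlip a (-((2 * α / K) • gradient g a))
  rw [← sub_eq_add_neg, inner_neg_right, inner_smul_right, real_inner_self_eq_norm_sq, norm_neg,
    norm_smul, mul_pow, Real.norm_eq_abs, sq_abs] at h
  have hcoeff : 2 * α / K * ‖gradient g a‖ ^ 2 -
      K / 2 * ((2 * α / K) ^ 2 * ‖gradient g a‖ ^ 2) =
      2 * α * (1 - α) / K * ‖gradient g a‖ ^ 2 := by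
    field_simp
  linarith

/-- If each `g t` is nonnegative and bounded by the decrease of a nonnegative sequence `u` at `t`,
the sum of `g` over finitely many times is at most the value of `u` at any earlier time. -/
theorem Finset.sum_le_of_le_sub_succ {u g : ℕ → ℝ} (hu : ∀ t, 0 ≤ u t) (hg : ∀ t, 0 ≤ g t)
    (h : ∀ t, g t ≤ u t - u (t + 1)) (T : Finset ℕ) (a : ℕ) (ha : ∀ t ∈ T, a ≤ t) :
    ∑ t ∈ T, g t ≤ u a := by
  have htel (b : ℕ) (hb : a ≤ b) : ∑ t ∈ Finset.Ico a b, g t ≤ u a - u b := by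
    induction b, hb using Nat.le_induction with
    | base => simp
    | succ b hb ih =>
      rw [Finset.sum_Ico_succ_top hb]
      linarith [h b]
  have hsub : T ⊆ Finset.Ico a (a + T.sup id + 1) := fun t ht => by
    have hle : t ≤ T.sup id := Finset.le_sup (f := id) ht
    have := ha t ht
    rw [Finset.mem_Ico]
    omega
  calc ∑ t ∈ T, g t ≤ ∑ t ∈ Finset.Ico a (a + T.sup id + 1), g t :=
        Finset.sum_le_sum_of_subset_of_nonneg hsub fun t _ _ => hg t
    _ ≤ u a - u (a + T.sup id + 1) := htel _ (by omega)
    _ ≤ u a := by linarith [hu (a + T.sup id + 1)]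

/-- Theorem 4: under the common model structure assumption, differentiable convex losses,
differentiable model, and Lipschitz gradient of the objective, gradient descent with stepsize
`2α/L_c` satisfies, for any finite set `T` of iterations at which `J(θ^t) β^t = η vec(Y*)`,
`min_{t∈T} L(θ^t) ≤ L*(η Y*) + (1/√|T|) √(L_c ζ L(θ^{t_0}) / (2α(1−α)))` with
`ζ = 4 max_{t∈T} max(‖ν(θ^t)‖², ‖β^t‖²)`. -/
theorem stmt_7
    (n mx my d : ℕ) (hn : 0 < n)
    (x : Fin n → EuclideanSpace ℝ (Fin mx))
    (y : Fin n → EuclideanSpace ℝ (Fin my))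
    (f : EuclideanSpace ℝ (Fin mx) → EuclideanSpace ℝ (Fin d) → EuclideanSpace ℝ (Fin my))
    (fX : EuclideanSpace ℝ (Fin d) → Fin n → EuclideanSpace ℝ (Fin my))
    (hfX : ∀ θ' i, fX θ' i = f (x i) θ')
    (ℓ : EuclideanSpace ℝ (Fin my) → EuclideanSpace ℝ (Fin my) → ℝ)
    (hℓnn : ∀ p q, 0 ≤ ℓ p q)
    -- common model structure assumption
    (S : Finset (Fin d))
    (hCMS : ∀ (i : Fin n) (θ' : EuclideanSpace ℝ (Fin d)),
      f (x i) θ' = ∑ k ∈ S, θ' k • fderiv ℝ (f (x i)) θ' (EuclideanSpace.single k 1))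
    (hℓdiff : ∀ i, Differentiable ℝ (fun q => ℓ q (y i)))
    (hℓconv : ∀ i, ConvexOn ℝ Set.univ (fun q => ℓ q (y i)))
    (hfdiff : ∀ i, Differentiable ℝ (f (x i)))
    (L : EuclideanSpace ℝ (Fin d) → ℝ)
    (hL : ∀ θ', L θ' = (1 / (n : ℝ)) * ∑ i, ℓ (f (x i) θ') (y i))
    -- ∇L is Lipschitz with constant Lc > 0
    (Lc : ℝ) (hLc : 0 < Lc)
    (hlip : ∀ a b, ‖gradient L a - gradient L b‖ ≤ Lc * ‖a - b‖)
    -- gradient descent with stepsize 2α/Lc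
    (α : ℝ) (hα : α ∈ Set.Ioo (0 : ℝ) 1)
    (θ : ℕ → EuclideanSpace ℝ (Fin d))
    (hupd : ∀ t, θ (t + 1) = θ t - (2 * α / Lc) • gradient L (θ t))
    (T : Finset ℕ) (hT : T.Nonempty)
    (Y : Fin n → EuclideanSpace ℝ (Fin my)) (η : ℝ)
    (β : ℕ → EuclideanSpace ℝ (Fin d))
    (hβ : ∀ t ∈ T, fderiv ℝ fX (θ t) (β t) = fun i => η • Y i)
    (ζ : ℝ)
    (hζ : ζ = 4 * T.sup' hT (fun t =>
      max (‖∑ k ∈ S, EuclideanSpace.single k (θ t k)‖ ^ 2) (‖β t‖ ^ 2))) :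
    T.inf' hT (fun t => L (θ t)) ≤
      (1 / (n : ℝ)) * ∑ i, ℓ (η • Y i) (y i) +
        (1 / Real.sqrt T.card) *
          Real.sqrt (Lc * ζ * L (θ (T.min' hT)) / (2 * α * (1 - α))) := by
  obtain ⟨hα0, hα1⟩ := hα
  have hLfun : L = fun θ' => (1 / (n : ℝ)) * ∑ i, ℓ (f (x i) θ') (y i) := funext hL
  have hterm (θ' : EuclideanSpace ℝ (Fin d)) (i : Fin n) :
      HasFDerivAt (fun θ' => ℓ (f (x i) θ') (y i))
        ((fderiv ℝ (fun q => ℓ q (y i)) (f (x i) θ')).comp (fderiv ℝ (f (x i)) θ')) θ' :=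
    (hℓdiff i (f (x i) θ')).hasFDerivAt.comp θ' (hfdiff i θ').hasFDerivAt
  have hLderiv (θ' : EuclideanSpace ℝ (Fin d)) :
      HasFDerivAt L ((1 / (n : ℝ)) • ∑ i, (fderiv ℝ (fun q => ℓ q (y i)) (f (x i) θ')).comp
        (fderiv ℝ (f (x i)) θ')) θ' := by
    rw [hLfun]
    exact (HasFDerivAt.fun_sum fun i _ => hterm θ' i).const_mul _
  have hLdiff : Differentiable ℝ L := fun θ' => (hLderiv θ').differentiableAt
  have hLnn (θ' : EuclideanSpace ℝ (Fin d)) : 0 ≤ L θ' := by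
    rw [hL]
    exact mul_nonneg (by positivity) (Finset.sum_nonneg fun i _ => hℓnn _ _)
  have hfXfun : fX = fun θ' i => f (x i) θ' := funext fun θ' => funext fun i => hfX θ' i
  set ν : ℕ → EuclideanSpace ℝ (Fin d) :=
    fun t => ∑ k ∈ S, EuclideanSpace.single k (θ t k) with hν
  have hνf (t : ℕ) (i : Fin n) : fderiv ℝ (f (x i)) (θ t) (ν t) = f (x i) (θ t) := by
    rw [hCMS i (θ t), hν, map_sum]
    refine Finset.sum_congr rfl fun k _ => ?_
    rw [← map_smul]
    congr 1
    ext j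
    simp [PiLp.single_apply]
  have hβf (t : ℕ) (ht : t ∈ T) (i : Fin n) : fderiv ℝ (f (x i)) (θ t) (β t) = η • Y i := by
    have hpi : HasFDerivAt fX (ContinuousLinearMap.pi fun i => fderiv ℝ (f (x i)) (θ t)) (θ t) := by
      rw [hfXfun]
      exact hasFDerivAt_pi.2 fun i => (hfdiff i (θ t)).hasFDerivAt
    have h := hβ t ht
    rw [hpi.fderiv] at h
    exact congrFun h i
  have hgap (t : ℕ) (ht : t ∈ T) :
      L (θ t) ≤ (1 / (n : ℝ)) * ∑ i, ℓ (η • Y i) (y i) +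
        ‖gradient L (θ t)‖ * (‖ν t‖ + ‖β t‖) := by
    have hconv : L (θ t) + fderiv ℝ L (θ t) (β t - ν t) ≤
        (1 / (n : ℝ)) * ∑ i, ℓ (η • Y i) (y i) := by
      have hdir (i : Fin n) :
          fderiv ℝ (f (x i)) (θ t) (β t - ν t) = η • Y i - f (x i) (θ t) := by
        rw [map_sub, hβf t ht, hνf]
      rw [(hLderiv (θ t)).fderiv, hL]
      simp only [smul_apply, sum_apply, ContinuousLinearMap.comp_apply, smul_eq_mul, hdir]
      rw [← mul_add, ← Finset.sum_add_distrib]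
      gcongr with i
      exact (hℓconv i).add_fderiv_le (hℓdiff i _) _
    have hcs : -fderiv ℝ L (θ t) (β t - ν t) ≤ ‖gradient L (θ t)‖ * (‖ν t‖ + ‖β t‖) := by
      rw [← map_neg, neg_sub, ← inner_gradient_left]
      exact (real_inner_le_norm _ _).trans (by gcongr; exact norm_sub_le _ _)
    linarith
  have hc : 0 < 2 * α * (1 - α) / Lc := by
    have := sub_pos.2 hα1
    positivity
  have hsum : ∑ t ∈ T, 2 * α * (1 - α) / Lc * ‖gradient L (θ t)‖ ^ 2 ≤ L (θ (T.min' hT)) := by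
    refine Finset.sum_le_of_le_sub_succ (u := fun t => L (θ t)) (fun t => hLnn _)
      (fun t => by positivity) (fun t => ?_) T _ fun t ht => T.min'_le t ht
    rw [hupd]
    exact gradient_step_decrease hLdiff hLc hlip α (θ t)
  obtain ⟨s, hs, hmin⟩ := T.exists_min_image (fun t => ‖gradient L (θ t)‖ ^ 2) hT
  have hcard : (0 : ℝ) < T.card := by exact_mod_cast hT.card_pos
  have hG : ‖gradient L (θ s)‖ ^ 2 ≤
      Lc * L (θ (T.min' hT)) / (2 * α * (1 - α)) / T.card := by
    have h : T.card • (2 * α * (1 - α) / Lc * ‖gradient L (θ s)‖ ^ 2) ≤ L (θ (T.min' hT)) :=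
      (T.card_nsmul_le_sum _ _ fun t ht =>
        mul_le_mul_of_nonneg_left (hmin t ht) hc.le).trans hsum
    have hpos : 0 < 2 * α * (1 - α) := by
      have := sub_pos.2 hα1
      positivity
    rw [nsmul_eq_mul] at h
    rw [le_div_iff₀ hcard, le_div_iff₀ hpos]
    calc ‖gradient L (θ s)‖ ^ 2 * T.card * (2 * α * (1 - α))
        = Lc * (T.card * (2 * α * (1 - α) / Lc * ‖gradient L (θ s)‖ ^ 2)) := by field_simp
      _ ≤ Lc * L (θ (T.min' hT)) := by gcongr
  have hζs : (‖ν s‖ + ‖β s‖) ^ 2 ≤ ζ := by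
    have h := Finset.le_sup' (fun t => max (‖ν t‖ ^ 2) (‖β t‖ ^ 2)) hs
    have hν' := (le_max_left (‖ν s‖ ^ 2) (‖β s‖ ^ 2)).trans h
    have hβ' := (le_max_right (‖ν s‖ ^ 2) (‖β s‖ ^ 2)).trans h
    rw [hζ]
    nlinarith [sq_nonneg (‖ν s‖ - ‖β s‖)]
  have hfinal : ‖gradient L (θ s)‖ * (‖ν s‖ + ‖β s‖) ≤ (1 / Real.sqrt T.card) *
      Real.sqrt (Lc * ζ * L (θ (T.min' hT)) / (2 * α * (1 - α))) := by
    rw [one_div_mul_eq_div, ← Real.sqrt_div' _ hcard.le]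
    refine Real.le_sqrt_of_sq_le ?_
    calc (‖gradient L (θ s)‖ * (‖ν s‖ + ‖β s‖)) ^ 2
        = ‖gradient L (θ s)‖ ^ 2 * (‖ν s‖ + ‖β s‖) ^ 2 := mul_pow _ _ _
      _ ≤ Lc * L (θ (T.min' hT)) / (2 * α * (1 - α)) / T.card * ζ :=
        mul_le_mul hG hζs (sq_nonneg _) ((sq_nonneg _).trans hG)
      _ = Lc * ζ * L (θ (T.min' hT)) / (2 * α * (1 - α)) / T.card := by ring
  calc T.inf' hT (fun t => L (θ t)) ≤ L (θ s) := Finset.inf'_le _ hs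
    _ ≤ _ := (hgap s hs).trans (by gcongr)
end

section
/- Suppose σ̃ is real analytic on ℝ and, for each i ∈ {1,...,n}, the map u ↦ z(x_i,u) is real analytic on ℝ^{d'}. Suppose the safe-exploration condition holds: there exist q ∈ ℝ^{m_{H-1}×m_H} and u ∈ ℝ^{d'} with rank(φ(q,u)) = n. Then the set {(R,u,w) ∈ ℝ^{m_{H-1}×m_H} × ℝ^{d'} × ℝ^{m_H} : rank(φ(R,u)·(diag(w) ⊗ I_{m_{H-1}})) ≠ n}, viewed as a subset of ℝ^{m_H·m_{H-1} + d' + m_H}, has Lebesgue measure zero. (Lemma 4 of the appendix, lemma:2.) -/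
open scoped Kronecker

open MeasureTheory Measure Set

/-- The zero set of a real analytic function that does not vanish identically is null for every
Haar measure. -/
theorem AnalyticOnNhd.addHaar_setOf_eq_zero
    {E : Type*} [NormedAddCommGroup E] [NormedSpace ℝ E] [FiniteDimensional ℝ E]
    [MeasurableSpace E] [BorelSpace E] (μ : Measure E) [IsAddHaarMeasure μ]
    {f : E → ℝ} (hf : AnalyticOnNhd ℝ f univ) {p : E} (hp : f p ≠ 0) :
    μ {y | f y = 0} = 0 := by
  have hc : Continuous f := continuousOn_univ.1 hf.continuousOn
  have hline (v : E) : ∀ᵐ t : ℝ, f (p + t • v) ≠ 0 := by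
    have hg : AnalyticOnNhd ℝ (fun t : ℝ => f (p + t • v)) univ := fun t _ =>
      (hf (p + t • v) (mem_univ _)).fun_comp (f := fun t : ℝ => p + t • v) (by fun_prop)
    have h := hg.preimage_zero_mem_codiscrete (x := 0) (by simpa using hp)
    have h' := ae_restrict_le_codiscreteWithin (μ := volume) MeasurableSet.univ h
    rw [restrict_univ] at h'
    exact h'
  have hmeas : MeasurableSet {q : E × ℝ | f (p + q.2 • q.1) ≠ 0} :=
    (isOpen_ne_fun (by fun_prop) continuous_const).measurableSet
  have hswap : ∀ᵐ t : ℝ, ∀ᵐ v ∂μ, f (p + t • v) ≠ 0 :=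
    (ae_ae_comm hmeas).1 (ae_of_all _ hline)
  obtain ⟨t, ht, ht0⟩ := (hswap.and (ae_iff.2 (by simp : volume {t : ℝ | ¬ t ≠ 0} = 0))).exists
  have hnull : μ ((fun v => t • v) ⁻¹' ((fun v => p + v) ⁻¹' {y | f y = 0})) = 0 := by
    simpa [ae_iff] using ht
  rw [addHaar_preimage_smul μ ht0, measure_preimage_add] at hnull
  simpa [ht0] using hnull

/-- The determinant of a matrix of analytic functions is analytic. -/
theorem AnalyticOnNhd.matrix_det {𝕜 E ι : Type*} [NontriviallyNormedField 𝕜]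
    [NormedAddCommGroup E] [NormedSpace 𝕜 E] [Fintype ι] [DecidableEq ι]
    {s : Set E} {A : E → Matrix ι ι 𝕜} (hA : ∀ i j, AnalyticOnNhd 𝕜 (fun p => A p i j) s) :
    AnalyticOnNhd 𝕜 (fun p => (A p).det) s := by
  simp only [Matrix.det_apply']
  exact Finset.analyticOnNhd_fun_sum _ fun τ _ =>
    analyticOnNhd_const.mul (Finset.analyticOnNhd_fun_prod _ fun i _ => hA _ _)

/-- A real matrix has full row rank iff its Gram determinant does not vanish. -/
theorem Matrix.rank_eq_card_iff_det_mul_transpose_ne_zero {ι κ : Type*} [Fintype ι] [Fintype κ]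
    [DecidableEq ι] (M : Matrix ι κ ℝ) :
    M.rank = Fintype.card ι ↔ (M * M.transpose).det ≠ 0 := by
  rw [← Matrix.rank_self_mul_transpose, ← isUnit_iff_ne_zero, ← Matrix.isUnit_iff_isUnit_det]
  refine ⟨fun h => ?_, Matrix.rank_of_isUnit _⟩
  rw [← Matrix.mulVec_surjective_iff_isUnit, ← Matrix.coe_mulVecLin, ← LinearMap.range_eq_top]
  exact Submodule.eq_top_of_finrank_eq (by simpa [Matrix.rank] using h)

/-- Lemma 4 of the appendix (`lemma:2`): under real analyticity of `σ̃` and `u ↦ z(x_i,u)` and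
the safe-exploration condition, the set of tuples `(R, u, w)` for which the matrix
`φ(R,u) (diag(w) ⊗ I)` fails to have rank `n` has Lebesgue measure zero. The ambient space
`ℝ^{m_H m_{H-1}} × ℝ^{d'} × ℝ^{m_H}` is represented as a product of function spaces with the
product (Lebesgue) measure, and the columns of `φ` are indexed by pairs `(k, l)`. -/
theorem stmt_9
    (n mx mH mH1 d' : ℕ) (hn : 0 < n) (hmH : 0 < mH) (hmH1 : 0 < mH1)
    (x : Fin n → Fin mx → ℝ)
    (z : (Fin mx → ℝ) → (Fin d' → ℝ) → (Fin mH1 → ℝ))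
    (σt : ℝ → ℝ)
    (φ : (Fin mH1 → Fin mH → ℝ) → (Fin d' → ℝ) → Matrix (Fin n) (Fin mH × Fin mH1) ℝ)
    (hφ : ∀ q u i kl, φ q u i kl = σt (∑ l, z (x i) u l * q l kl.1) * z (x i) u kl.2)
    (hσ : AnalyticOnNhd ℝ σt Set.univ)
    (hz : ∀ i, AnalyticOnNhd ℝ (z (x i)) Set.univ)
    -- safe-exploration condition
    (hsafe : ∃ q u, (φ q u).rank = n) :
    MeasureTheory.volume
      {p : (Fin mH1 → Fin mH → ℝ) × (Fin d' → ℝ) × (Fin mH → ℝ) |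
        (φ p.1 p.2.1 *
            (Matrix.diagonal p.2.2 ⊗ₖ (1 : Matrix (Fin mH1) (Fin mH1) ℝ))).rank ≠ n} = 0 := by
  have hentry (p : (Fin mH1 → Fin mH → ℝ) × (Fin d' → ℝ) × (Fin mH → ℝ)) (i : Fin n)
      (kl : Fin mH × Fin mH1) :
      (φ p.1 p.2.1 * (Matrix.diagonal p.2.2 ⊗ₖ (1 : Matrix (Fin mH1) (Fin mH1) ℝ))) i kl =
        σt (∑ l, z (x i) p.2.1 l * p.1 l kl.1) * z (x i) p.2.1 kl.2 * p.2.2 kl.1 := by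
    rw [← Matrix.diagonal_one, Matrix.diagonal_kronecker_diagonal, Matrix.mul_diagonal, hφ,
      mul_one]
  have hzc (i : Fin n) (l : Fin mH1) : AnalyticOnNhd ℝ
      (fun p : (Fin mH1 → Fin mH → ℝ) × (Fin d' → ℝ) × (Fin mH → ℝ) => z (x i) p.2.1 l) univ := by
    intro p _
    have h := (hz i p.2.1 (mem_univ _)).fun_comp
      (f := fun p : (Fin mH1 → Fin mH → ℝ) × (Fin d' → ℝ) × (Fin mH → ℝ) => p.2.1)
      (((ContinuousLinearMap.fst ℝ (Fin d' → ℝ) (Fin mH → ℝ)).comp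
        (ContinuousLinearMap.snd ℝ (Fin mH1 → Fin mH → ℝ) _)).analyticAt p)
    exact ((ContinuousLinearMap.proj (R := ℝ) (φ := fun _ : Fin mH1 => ℝ) l).analyticAt _).fun_comp h
  have hR (l : Fin mH1) (k : Fin mH) : AnalyticOnNhd ℝ
      (fun p : (Fin mH1 → Fin mH → ℝ) × (Fin d' → ℝ) × (Fin mH → ℝ) => p.1 l k) univ :=
    ((ContinuousLinearMap.proj (R := ℝ) (φ := fun _ : Fin mH => ℝ) k).comp
      ((ContinuousLinearMap.proj (R := ℝ) (φ := fun _ : Fin mH1 => Fin mH → ℝ) l).comp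
        (ContinuousLinearMap.fst ℝ (Fin mH1 → Fin mH → ℝ)
          ((Fin d' → ℝ) × (Fin mH → ℝ))))).analyticOnNhd _
  have hw (k : Fin mH) : AnalyticOnNhd ℝ
      (fun p : (Fin mH1 → Fin mH → ℝ) × (Fin d' → ℝ) × (Fin mH → ℝ) => p.2.2 k) univ :=
    ((ContinuousLinearMap.proj (R := ℝ) (φ := fun _ : Fin mH => ℝ) k).comp
      ((ContinuousLinearMap.snd ℝ (Fin d' → ℝ) (Fin mH → ℝ)).comp
        (ContinuousLinearMap.snd ℝ (Fin mH1 → Fin mH → ℝ) _))).analyticOnNhd _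
  have hM (i : Fin n) (kl : Fin mH × Fin mH1) : AnalyticOnNhd ℝ
      (fun p : (Fin mH1 → Fin mH → ℝ) × (Fin d' → ℝ) × (Fin mH → ℝ) =>
        (φ p.1 p.2.1 * (Matrix.diagonal p.2.2 ⊗ₖ (1 : Matrix (Fin mH1) (Fin mH1) ℝ))) i kl)
      univ := by
    simp only [hentry]
    exact ((hσ.comp (Finset.analyticOnNhd_fun_sum _ fun l _ => (hzc i l).mul (hR l kl.1))
      (mapsTo_univ _ _)).mul (hzc i kl.2)).mul (hw kl.1)
  have hdet := AnalyticOnNhd.matrix_det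
    (A := fun p : (Fin mH1 → Fin mH → ℝ) × (Fin d' → ℝ) × (Fin mH → ℝ) =>
      (φ p.1 p.2.1 * (Matrix.diagonal p.2.2 ⊗ₖ (1 : Matrix (Fin mH1) (Fin mH1) ℝ))) *
      (φ p.1 p.2.1 * (Matrix.diagonal p.2.2 ⊗ₖ (1 : Matrix (Fin mH1) (Fin mH1) ℝ))).transpose)
    (s := univ) fun i j => by
      simp only [Matrix.mul_apply (N := Matrix.transpose _), Matrix.transpose_apply]
      exact Finset.analyticOnNhd_fun_sum _ fun kl _ => (hM i kl).mul (hM j kl)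
  obtain ⟨q, u, hqu⟩ := hsafe
  have hne := (Matrix.rank_eq_card_iff_det_mul_transpose_ne_zero (φ q u)).1 (by simpa using hqu)
  have hF (k : ℕ) : IsAddHaarMeasure (volume : Measure (Fin k → ℝ)) :=
    inferInstanceAs (IsAddHaarMeasure (Measure.pi fun _ : Fin k => (volume : Measure ℝ)))
  have hpi : IsAddHaarMeasure (volume : Measure (Fin mH1 → Fin mH → ℝ)) :=
    inferInstanceAs (IsAddHaarMeasure (Measure.pi fun _ : Fin mH1 => (volume : Measure (Fin mH → ℝ))))
  have hpair : IsAddHaarMeasure (volume : Measure ((Fin d' → ℝ) × (Fin mH → ℝ))) :=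
    prod.instIsAddHaarMeasure volume volume
  have hprod : IsAddHaarMeasure
      (volume : Measure ((Fin mH1 → Fin mH → ℝ) × (Fin d' → ℝ) × (Fin mH → ℝ))) :=
    prod.instIsAddHaarMeasure volume volume
  refine measure_mono_null (fun p hp => ?_)
    (AnalyticOnNhd.addHaar_setOf_eq_zero volume hdet (p := (q, u, fun _ => 1)) (by simpa using hne))
  by_contra h
  exact hp (by simpa using (Matrix.rank_eq_card_iff_det_mul_transpose_ne_zero _).2 h)
end

section
/- Assume each ℓ_i : ℝ^{m_y} → [0,∞) is differentiable. Then L̂ is differentiable and, for each j ∈ {1,...,m_y}, the gradient of L̂ with respect to the vector vec((W^{(j)})ᵀ) ∈ ℝ^{m_H·m_{H-1}} (the concatenation of the rows of W^{(j)} as column vectors) equals (diag(a^{(j)}) ⊗ I_{m_{H-1}})·φ(R^{(j)},u)ᵀ·r_j(W), where r_j(W) = (1/n)·(∂_j ℓ_1(F(W)_{1*}), ..., ∂_j ℓ_n(F(W)_{n*}))ᵀ ∈ ℝ^n and ∂_j ℓ_i denotes the j-th partial derivative of ℓ_i. (Lemma 7 of the appendix, lemma:3.) -/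
open scoped Kronecker Matrix

/-- The coordinates of the gradient on a Euclidean space are the partial derivatives. -/
theorem EuclideanSpace.gradient_apply {ι : Type*} [Fintype ι] [DecidableEq ι]
    (f : EuclideanSpace ℝ ι → ℝ) (x : EuclideanSpace ℝ ι) (i : ι) :
    gradient f x i = fderiv ℝ f x (EuclideanSpace.single i 1) := by
  have h : inner ℝ (gradient f x) (EuclideanSpace.single i (1 : ℝ)) =
      fderiv ℝ f x (EuclideanSpace.single i 1) := by
    simp [gradient]
  simpa only [EuclideanSpace.inner_single_right, one_mul, conj_trivial] using h

/-- The linear map sending the blocks `(W j k l)` to the vector with `j`-th coordinate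
`∑ k, c j k * ∑ l, W (j, k, l) * v l`. -/
noncomputable def blockSumCLM {ι κ μ : Type*} [Fintype ι] [Fintype κ] [Fintype μ]
    (c : ι → κ → ℝ) (v : μ → ℝ) :
    EuclideanSpace ℝ (ι × κ × μ) →L[ℝ] EuclideanSpace ℝ ι :=
  LinearMap.toContinuousLinearMap
    { toFun := fun W => WithLp.toLp 2 fun j => ∑ k, c j k * ∑ l, W (j, k, l) * v l
      map_add' := fun W V => by
        ext j
        simp [add_mul, mul_add, Finset.sum_add_distrib]
      map_smul' := fun t W => by
        ext j
        simp only [PiLp.smul_apply, smul_eq_mul, RingHom.id_apply, Finset.mul_sum]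
        exact Finset.sum_congr rfl fun k _ => Finset.sum_congr rfl fun l _ => by ring }

theorem blockSumCLM_apply {ι κ μ : Type*} [Fintype ι] [Fintype κ] [Fintype μ]
    (c : ι → κ → ℝ) (v : μ → ℝ) (W : EuclideanSpace ℝ (ι × κ × μ)) (j : ι) :
    blockSumCLM c v W j = ∑ k, c j k * ∑ l, W (j, k, l) * v l :=
  rfl

theorem blockSumCLM_single {ι κ μ : Type*} [Fintype ι] [Fintype κ] [Fintype μ]
    [DecidableEq ι] [DecidableEq κ] [DecidableEq μ]
    (c : ι → κ → ℝ) (v : μ → ℝ) (j : ι) (k : κ) (l : μ) :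
    blockSumCLM c v (EuclideanSpace.single (j, k, l) 1) =
      (c j k * v l) • EuclideanSpace.single j (1 : ℝ) := by
  ext j'
  rw [blockSumCLM_apply]
  by_cases h : j' = j
  · subst h
    simp [Prod.ext_iff, ite_and, Finset.sum_ite_irrel]
  · simp [Prod.ext_iff, h]

/-- Lemma 7 of the appendix (`lemma:3`): with differentiable losses `ℓ_i`, the objective `L̂`
is differentiable and, for each output coordinate `j`, the block of its gradient corresponding
to `vec((W^{(j)})ᵀ)` (the components `(j,k,l)` of the gradient, indexed by pairs `(k,l)`)
equals `(diag(a^{(j)}) ⊗ I) φ(R^{(j)},u)ᵀ r_j(W)`, where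
`r_j(W)_i = (1/n) ∂_j ℓ_i(F(W)_{i*})`. -/
theorem stmt_12
    (n mx mH mH1 d' my : ℕ) (hn : 0 < n)
    (x : Fin n → Fin mx → ℝ)
    (z : (Fin mx → ℝ) → (Fin d' → ℝ) → (Fin mH1 → ℝ))
    (σt : ℝ → ℝ)
    (φ : (Fin mH1 → Fin mH → ℝ) → (Fin d' → ℝ) → Matrix (Fin n) (Fin mH × Fin mH1) ℝ)
    (hφ : ∀ q u i kl, φ q u i kl = σt (∑ l, z (x i) u l * q l kl.1) * z (x i) u kl.2)
    (u : Fin d' → ℝ)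
    (R : Fin my → Fin mH1 → Fin mH → ℝ)
    (a : Fin my → Fin mH → ℝ)
    (ℓ : Fin n → EuclideanSpace ℝ (Fin my) → ℝ)
    (hℓnn : ∀ i p, 0 ≤ ℓ i p)
    (hℓdiff : ∀ i, Differentiable ℝ (ℓ i))
    (F : EuclideanSpace ℝ (Fin my × Fin mH × Fin mH1) → Fin n → EuclideanSpace ℝ (Fin my))
    (hF : ∀ W i j, F W i j =
      ∑ k, a j k * σt (∑ l, z (x i) u l * R j l k) * (∑ l, W (j, k, l) * z (x i) u l))
    (Lhat : EuclideanSpace ℝ (Fin my × Fin mH × Fin mH1) → ℝ)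
    (hLhat : ∀ W, Lhat W = (1 / (n : ℝ)) * ∑ i, ℓ i (F W i)) :
    Differentiable ℝ Lhat ∧
    ∀ (W : EuclideanSpace ℝ (Fin my × Fin mH × Fin mH1)) (j : Fin my),
      (fun kl : Fin mH × Fin mH1 => gradient Lhat W (j, kl.1, kl.2)) =
        ((Matrix.diagonal (a j) ⊗ₖ (1 : Matrix (Fin mH1) (Fin mH1) ℝ)) *
            (φ (R j) u)ᵀ).mulVec
          (fun i => (1 / (n : ℝ)) * gradient (ℓ i) (F W i) j) := by
  have hFA : ∀ W i, F W i =
      blockSumCLM (fun j k => a j k * σt (∑ l, z (x i) u l * R j l k)) (z (x i) u) W := by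
    intro W i
    ext j
    rw [hF, blockSumCLM_apply]
  have hderiv : ∀ W, HasFDerivAt Lhat ((1 / (n : ℝ)) • ∑ i, (fderiv ℝ (ℓ i) (F W i)).comp
      (blockSumCLM (fun j k => a j k * σt (∑ l, z (x i) u l * R j l k)) (z (x i) u))) W := by
    intro W
    rw [funext hLhat]
    refine HasFDerivAt.const_mul (HasFDerivAt.fun_sum fun i _ => ?_) _
    simp only [hFA]
    exact (hℓdiff i _).hasFDerivAt.comp W (ContinuousLinearMap.hasFDerivAt _)
  refine ⟨fun W => (hderiv W).differentiableAt, fun W j => ?_⟩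
  ext ⟨k, l⟩
  have hkron : Matrix.diagonal (a j) ⊗ₖ (1 : Matrix (Fin mH1) (Fin mH1) ℝ) =
      Matrix.diagonal fun kl : Fin mH × Fin mH1 => a j kl.1 := by
    rw [← Matrix.diagonal_one, Matrix.diagonal_kronecker_diagonal]
    simp
  rw [EuclideanSpace.gradient_apply, (hderiv W).fderiv, hkron]
  simp only [smul_apply, sum_apply,
    ContinuousLinearMap.comp_apply, blockSumCLM_single, map_smul, smul_eq_mul,
    Matrix.mulVec, dotProduct, Matrix.diagonal_mul, Matrix.transpose_apply, hφ,
    EuclideanSpace.gradient_apply, Finset.mul_sum]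
  exact Finset.sum_congr rfl fun i _ => by ring
end

section
/- Assume there is L_ℓ ≥ 0 such that each ℓ_i is differentiable with ‖∇ℓ_i(p) − ∇ℓ_i(q)‖ ≤ L_ℓ·‖p − q‖ for all p, q ∈ ℝ^{m_y}. Then ∇L̂ is Lipschitz with constant L̂_c = (L_ℓ/n)·Σ_{i=1}^n Z_i², i.e., ‖∇L̂(W') − ∇L̂(W)‖ ≤ L̂_c·‖W' − W‖ for all W, W', where Z_i = max_{j∈{1,...,m_y}} ‖(diag(a^{(j)}) ⊗ I_{m_{H-1}})·(φ(R^{(j)},u)_{i*})ᵀ‖ and φ(R^{(j)},u)_{i*} denotes the i-th row of φ(R^{(j)},u). (Lemma 8 of the appendix, lemma:5.) -/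
open scoped Kronecker Matrix

/-- A linear map whose `j`-th coordinate is the pairing of the `j`-th block of its argument with
a vector `v j` of norm at most `Z` has operator norm at most `Z`. -/
theorem norm_le_of_blockwise_inner {ι κ : Type*} [Fintype ι] [Fintype κ]
    (A : EuclideanSpace ℝ (ι × κ) →L[ℝ] EuclideanSpace ℝ ι) (v : ι → κ → ℝ) {Z : ℝ} (hZ : 0 ≤ Z)
    (hA : ∀ W j, A W j = ∑ c, v j c * W (j, c)) (hv : ∀ j, ∑ c, v j c ^ 2 ≤ Z ^ 2) :
    ‖A‖ ≤ Z := by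
  refine A.opNorm_le_bound hZ fun W => ?_
  refine le_of_sq_le_sq ?_ (by positivity)
  rw [mul_pow, EuclideanSpace.real_norm_sq_eq, EuclideanSpace.real_norm_sq_eq,
    Fintype.sum_prod_type, Finset.mul_sum]
  refine Finset.sum_le_sum fun j _ => ?_
  rw [hA]
  exact (Finset.sum_mul_sq_le_sq_mul_sq _ _ _).trans
    (mul_le_mul_of_nonneg_right (hv j) (Finset.sum_nonneg fun _ _ => sq_nonneg _))

theorem HasGradientAt.comp_continuousLinearMap {E G : Type*}
    [NormedAddCommGroup E] [InnerProductSpace ℝ E] [CompleteSpace E]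
    [NormedAddCommGroup G] [InnerProductSpace ℝ G] [CompleteSpace G]
    {f : G → ℝ} {g : G} (A : E →L[ℝ] G) {W : E} (hf : HasGradientAt f g (A W)) :
    HasGradientAt (fun W => f (A W)) (A.adjoint g) W := by
  rw [hasGradientAt_iff_hasFDerivAt] at hf ⊢
  refine (hf.comp W A.hasFDerivAt).congr_fderiv ?_
  ext y
  simp [ContinuousLinearMap.adjoint_inner_left]

/-- A nonnegative multiple of a sum of functions with `L`-Lipschitz gradients, each precomposed
with a continuous linear map `A i` with `‖A i‖ ≤ Z i`, has a Lipschitz gradient. -/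
theorem norm_gradient_sub_le_of_sum_comp {ι E G : Type*} [Fintype ι]
    [NormedAddCommGroup E] [InnerProductSpace ℝ E] [CompleteSpace E]
    [NormedAddCommGroup G] [InnerProductSpace ℝ G] [CompleteSpace G]
    (f : ι → G → ℝ) (A : ι → E →L[ℝ] G) (Z : ι → ℝ) {L c : ℝ} (hL : 0 ≤ L) (hc : 0 ≤ c)
    (hf : ∀ i, Differentiable ℝ (f i))
    (hlip : ∀ i p q, ‖gradient (f i) p - gradient (f i) q‖ ≤ L * ‖p - q‖)
    (hA : ∀ i, ‖A i‖ ≤ Z i) (W W' : E) :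
    ‖gradient (fun W => c * ∑ i, f i (A i W)) W' - gradient (fun W => c * ∑ i, f i (A i W)) W‖ ≤
      (L * c * ∑ i, Z i ^ 2) * ‖W' - W‖ := by
  have hgrad (W : E) : gradient (fun W => c * ∑ i, f i (A i W)) W =
      c • ∑ i, (A i).adjoint (gradient (f i) (A i W)) := by
    apply HasGradientAt.gradient
    rw [hasGradientAt_iff_hasFDerivAt]
    have h (i : ι) := ((hf i (A i W)).hasGradientAt.comp_continuousLinearMap
      (A i)).hasFDerivAt
    simpa only [map_smul, map_sum, LinearIsometryEquiv.coe_toLinearIsometry, conj_trivial,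
      map_smulₛₗ] using (HasFDerivAt.fun_sum (u := Finset.univ) fun i _ => h i).const_mul c
  have hterm (i : ι) : ‖(A i).adjoint (gradient (f i) (A i W')) -
      (A i).adjoint (gradient (f i) (A i W))‖ ≤ L * Z i ^ 2 * ‖W' - W‖ := by
    have hZ : 0 ≤ Z i := (norm_nonneg _).trans (hA i)
    rw [← map_sub]
    calc _ ≤ ‖A i‖ * ‖gradient (f i) (A i W') - gradient (f i) (A i W)‖ := by
          simpa using (A i).adjoint.le_opNorm
            (gradient (f i) (A i W') - gradient (f i) (A i W))
      _ ≤ Z i * (L * (Z i * ‖W' - W‖)) := by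
          gcongr
          · exact hA i
          · refine (hlip i _ _).trans ?_
            gcongr
            rw [← map_sub]
            exact (A i).le_of_opNorm_le (hA i) _
      _ = _ := by ring
  rw [hgrad, hgrad, ← smul_sub, ← Finset.sum_sub_distrib, norm_smul, Real.norm_of_nonneg hc]
  calc _ ≤ c * ∑ i, L * Z i ^ 2 * ‖W' - W‖ := by
        gcongr
        exact norm_sum_le_of_le _ fun i _ => hterm i
    _ = _ := by
        rw [← Finset.sum_mul, ← Finset.mul_sum]
        ring

/-- Lemma 8 of the appendix (`lemma:5`): with `L_ℓ`-Lipschitz gradients of the losses, the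
gradient of `L̂` is Lipschitz with constant `L̂_c = (L_ℓ/n) Σ_i Z_i²`, where
`Z_i = max_j ‖(diag(a^{(j)}) ⊗ I) (φ(R^{(j)},u)_{i*})ᵀ‖` (the Euclidean norm written as the
square root of the sum of squared entries). -/
theorem stmt_13
    (n mx mH mH1 d' my : ℕ) (hn : 0 < n) (hmy : 0 < my)
    (x : Fin n → Fin mx → ℝ)
    (z : (Fin mx → ℝ) → (Fin d' → ℝ) → (Fin mH1 → ℝ))
    (σt : ℝ → ℝ)
    (φ : (Fin mH1 → Fin mH → ℝ) → (Fin d' → ℝ) → Matrix (Fin n) (Fin mH × Fin mH1) ℝ)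
    (hφ : ∀ q u i kl, φ q u i kl = σt (∑ l, z (x i) u l * q l kl.1) * z (x i) u kl.2)
    (u : Fin d' → ℝ)
    (R : Fin my → Fin mH1 → Fin mH → ℝ)
    (a : Fin my → Fin mH → ℝ)
    (ℓ : Fin n → EuclideanSpace ℝ (Fin my) → ℝ)
    (hℓnn : ∀ i p, 0 ≤ ℓ i p)
    (Lℓ : ℝ) (hLℓ : 0 ≤ Lℓ)
    (hℓdiff : ∀ i, Differentiable ℝ (ℓ i))
    (hℓlip : ∀ i p q, ‖gradient (ℓ i) p - gradient (ℓ i) q‖ ≤ Lℓ * ‖p - q‖)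
    (F : EuclideanSpace ℝ (Fin my × Fin mH × Fin mH1) → Fin n → EuclideanSpace ℝ (Fin my))
    (hF : ∀ W i j, F W i j =
      ∑ k, a j k * σt (∑ l, z (x i) u l * R j l k) * (∑ l, W (j, k, l) * z (x i) u l))
    (Lhat : EuclideanSpace ℝ (Fin my × Fin mH × Fin mH1) → ℝ)
    (hLhat : ∀ W, Lhat W = (1 / (n : ℝ)) * ∑ i, ℓ i (F W i))
    (Z : Fin n → ℝ)
    (hZ : ∀ i, Z i = ⨆ j : Fin my,
      Real.sqrt (∑ c, (((Matrix.diagonal (a j) ⊗ₖ (1 : Matrix (Fin mH1) (Fin mH1) ℝ)).mulVec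
        (fun c' => φ (R j) u i c')) c) ^ 2)) :
    ∀ W W' : EuclideanSpace ℝ (Fin my × Fin mH × Fin mH1),
      ‖gradient Lhat W' - gradient Lhat W‖ ≤ ((Lℓ / (n : ℝ)) * ∑ i, Z i ^ 2) * ‖W' - W‖ := by
  intro W W'
  have hlin (i : Fin n) : ∃ A : EuclideanSpace ℝ (Fin my × Fin mH × Fin mH1) →L[ℝ]
      EuclideanSpace ℝ (Fin my), ∀ W, A W = F W i := by
    refine ⟨LinearMap.toContinuousLinearMap
      { toFun := fun W => F W i, map_add' := fun W W' => ?_, map_smul' := fun r W => ?_ },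
      fun W => rfl⟩
    · ext j
      simp only [hF, PiLp.add_apply, add_mul, mul_add, Finset.sum_add_distrib]
    · ext j
      simp only [hF, PiLp.smul_apply, smul_eq_mul, RingHom.id_apply, mul_assoc, ← Finset.mul_sum,
        mul_left_comm _ r]
  choose A hA using hlin
  have hvec (i : Fin n) (j : Fin my) (c : Fin mH × Fin mH1) :
      (Matrix.diagonal (a j) ⊗ₖ (1 : Matrix (Fin mH1) (Fin mH1) ℝ)).mulVec
        (fun c' => φ (R j) u i c') c = a j c.1 * φ (R j) u i c := by
    rw [← Matrix.diagonal_one, Matrix.diagonal_kronecker_diagonal, Matrix.mulVec_diagonal, mul_one]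
  simp only [hvec] at hZ
  have hZ0 (i : Fin n) : 0 ≤ Z i := hZ i ▸ Real.iSup_nonneg fun _ => Real.sqrt_nonneg _
  have hAZ (i : Fin n) : ‖A i‖ ≤ Z i := by
    refine norm_le_of_blockwise_inner (A i) (fun j c => a j c.1 * φ (R j) u i c) (hZ0 i)
      (fun W j => ?_) fun j => ?_
    · rw [hA, hF, Fintype.sum_prod_type]
      refine Finset.sum_congr rfl fun k _ => ?_
      rw [Finset.mul_sum]
      refine Finset.sum_congr rfl fun l _ => ?_
      rw [hφ]
      ring
    · rw [← Real.sqrt_le_left (hZ0 i), hZ]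
      exact le_ciSup (f := fun j => √(∑ c, (a j c.1 * φ (R j) u i c) ^ 2))
        (Set.finite_range _).bddAbove j
  have hfun : Lhat = fun W => (1 / (n : ℝ)) * ∑ i, ℓ i (A i W) := by
    funext W
    simp only [hLhat, hA]
  rw [hfun, div_eq_mul_one_div Lℓ]
  exact norm_gradient_sub_le_of_sum_comp ℓ A Z hLℓ (by positivity) hℓdiff hℓlip hAZ W W'
end

section
/- If the rank condition holds, then the map W ↦ F(W) from (ℝ^{m_H×m_{H-1}})^{m_y} to ℝ^{n×m_y} is surjective; consequently, for every q_1,...,q_n ∈ ℝ^{m_y} there exists W with L̂(W) = (1/n) Σ_{i=1}^n ℓ_i(q_i). (Key expressivity step, equations (79)–(82) in the proof of Theorem 6.) -/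
open scoped Kronecker Matrix

/-- A matrix whose rank equals its number of rows is surjective as a linear map. -/
theorem Matrix.mulVec_surjective_of_rank_eq_card {K m ι : Type*} [Field K] [Fintype m] [Fintype ι]
    (A : Matrix m ι K) (h : A.rank = Fintype.card m) : Function.Surjective A.mulVec := by
  have htop : LinearMap.range A.mulVecLin = ⊤ := by
    apply Submodule.eq_top_of_finrank_eq
    rw [Module.finrank_fintype_fun_eq_card]
    exact h
  exact LinearMap.range_eq_top.mp htop

/-- Entries of a matrix multiplied on the right by `diag(d) ⊗ 1`. -/
theorem Matrix.mul_diagonal_kronecker_one_apply {S m ι κ : Type*} [CommSemiring S]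
    [Fintype ι] [Fintype κ] [DecidableEq ι] [DecidableEq κ]
    (A : Matrix m (ι × κ) S) (d : ι → S) (i : m) (p : ι × κ) :
    (A * (Matrix.diagonal d ⊗ₖ (1 : Matrix κ κ S))) i p = A i p * d p.1 := by
  rw [← Matrix.diagonal_one, Matrix.diagonal_kronecker_diagonal, Matrix.mul_diagonal, mul_one]

/-- Key expressivity step (equations (79)–(82) in the proof of Theorem 6): under the rank
condition, the map `W ↦ F(W)` is surjective onto `ℝ^{n×m_y}` (represented row-wise), and hence
every value `(1/n) Σ_i ℓ_i(q_i)` is attained by `L̂`. -/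
theorem stmt_14
    (n mx mH mH1 d' my : ℕ) (hn : 0 < n)
    (x : Fin n → Fin mx → ℝ)
    (z : (Fin mx → ℝ) → (Fin d' → ℝ) → (Fin mH1 → ℝ))
    (σt : ℝ → ℝ)
    (φ : (Fin mH1 → Fin mH → ℝ) → (Fin d' → ℝ) → Matrix (Fin n) (Fin mH × Fin mH1) ℝ)
    (hφ : ∀ q u i kl, φ q u i kl = σt (∑ l, z (x i) u l * q l kl.1) * z (x i) u kl.2)
    (u : Fin d' → ℝ)
    (R : Fin my → Fin mH1 → Fin mH → ℝ)
    (a : Fin my → Fin mH → ℝ)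
    (ℓ : Fin n → EuclideanSpace ℝ (Fin my) → ℝ)
    (hℓnn : ∀ i p, 0 ≤ ℓ i p)
    (F : EuclideanSpace ℝ (Fin my × Fin mH × Fin mH1) → Fin n → EuclideanSpace ℝ (Fin my))
    (hF : ∀ W i j, F W i j =
      ∑ k, a j k * σt (∑ l, z (x i) u l * R j l k) * (∑ l, W (j, k, l) * z (x i) u l))
    (Lhat : EuclideanSpace ℝ (Fin my × Fin mH × Fin mH1) → ℝ)
    (hLhat : ∀ W, Lhat W = (1 / (n : ℝ)) * ∑ i, ℓ i (F W i))
    -- the rank condition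
    (hrank : ∀ j, (φ (R j) u *
      (Matrix.diagonal (a j) ⊗ₖ (1 : Matrix (Fin mH1) (Fin mH1) ℝ))).rank = n) :
    Function.Surjective F ∧
    ∀ q : Fin n → EuclideanSpace ℝ (Fin my),
      ∃ W, Lhat W = (1 / (n : ℝ)) * ∑ i, ℓ i (q i) := by
  have hsurj : Function.Surjective F := by
    intro q
    have hsol : ∀ j, ∃ v : Fin mH × Fin mH1 → ℝ, (φ (R j) u *
        (Matrix.diagonal (a j) ⊗ₖ (1 : Matrix (Fin mH1) (Fin mH1) ℝ))) *ᵥ v = fun i => q i j :=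
      fun j => Matrix.mulVec_surjective_of_rank_eq_card _ (by simpa using hrank j) _
    choose v hv using hsol
    refine ⟨WithLp.toLp 2 fun p => v p.1 p.2, ?_⟩
    ext i j
    rw [hF, ← congrFun (hv j) i]
    simp only [Matrix.mulVec, dotProduct, Matrix.mul_diagonal_kronecker_one_apply, hφ,
      Fintype.sum_prod_type, Finset.mul_sum]
    exact Finset.sum_congr rfl fun k _ => Finset.sum_congr rfl fun l _ => by ring
  refine ⟨hsurj, fun q => ?_⟩
  obtain ⟨W, hW⟩ := hsurj q
  exact ⟨W, by rw [hLhat, hW]⟩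
end

section
/- Assume: each ℓ_i is differentiable with L_ℓ-Lipschitz gradient (‖∇ℓ_i(p) − ∇ℓ_i(q)‖ ≤ L_ℓ·‖p − q‖ for all p,q) and is invex, meaning there exists a function η_i : ℝ^{m_y}×ℝ^{m_y} → ℝ^{m_y} with ℓ_i(p) ≥ ℓ_i(q) + ⟨∇ℓ_i(q), η_i(p,q)⟩ for all p,q; the rank condition holds; and L̂_c = (L_ℓ/n)·Σ_{i=1}^n Z_i² > 0, where Z_i = max_{j} ‖(diag(a^{(j)}) ⊗ I_{m_{H-1}})·(φ(R^{(j)},u)_{i*})ᵀ‖. Let c̲, c̄ > 0 and let (W^t)_{t≥τ} satisfy W^{t+1} = W^t − α^t·ĝ^t with c̲·‖∇L̂(W^t)‖² ≤ ⟨∇L̂(W^t), ĝ^t⟩ and ‖ĝ^t‖² ≤ c̄·‖∇L̂(W^t)‖² for all t ≥ τ, where either (i) there is ε > 0 with ε ≤ α^t ≤ c̲·(2−ε)/(L̂_c·c̄) for all t ≥ τ, or (ii) α^t ≥ 0, α^t → 0 and Σ_{t≥τ} α^t = ∞. Then every limit point Ŵ of (W^t)_{t≥τ} satisfies L̂(Ŵ)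 ≤ (1/n) Σ_{i=1}^n ℓ_i(q_i) for every q_1,...,q_n ∈ ℝ^{m_y}, i.e., Ŵ is a global minimizer of L̂. (Deterministic core of Theorem 5, on the probability-one event established by the appendix Lemma lemma:4.) -/
open Filter
open scoped Kronecker Matrix RealInnerProductSpace

/-- Nonnegative values that decrease by at least `c * α t * G t` force `G` to `0`, when `G` varies
slowly relative to `α t * G t` and the step sizes `α` have divergent sum. -/
theorem tendsto_zero_of_sufficient_decrease {f G α : ℕ → ℝ} {c K : ℝ} (hc : 0 < c)
    (hf : ∀ t, 0 ≤ f t) (hG : ∀ t, 0 ≤ G t) (hα : ∀ t, 0 ≤ α t)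
    (hdec : ∀ t, f (t + 1) ≤ f t - c * (α t * G t))
    (hvar : ∀ t, |G (t + 1) - G t| ≤ K * (α t * G t))
    (hsum : ¬ Summable α) : Tendsto G atTop (nhds 0) := by
  have hs : Summable fun t => α t * G t := by
    refine summable_of_sum_range_le (c := f 0 / c) (fun t => mul_nonneg (hα t) (hG t)) fun N => ?_
    have h : ∀ N, c * ∑ t ∈ Finset.range N, α t * G t ≤ f 0 - f N := by
      intro N
      induction N with
      | zero => simp
      | succ N ih =>
        rw [Finset.sum_range_succ, mul_add]
        linarith [hdec N]
    rw [le_div_iff₀ hc]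
    linarith [h N, hf N]
  have hcau : CauchySeq G := by
    refine cauchySeq_of_dist_le_of_summable _ (fun t => ?_) (hs.mul_left K)
    rw [dist_comm, Real.dist_eq]
    exact hvar t
  obtain ⟨b, hb⟩ := cauchySeq_tendsto_of_complete hcau
  have hb0 : 0 ≤ b := ge_of_tendsto' hb hG
  rcases hb0.eq_or_lt with rfl | hbpos
  · exact hb
  · refine absurd ?_ hsum
    refine Summable.of_norm_bounded_eventually_nat (hs.mul_left (2 / b)) ?_
    filter_upwards [hb.eventually (lt_mem_nhds (half_lt_self hbpos))] with t ht
    rw [Real.norm_of_nonneg (hα t), div_mul_eq_mul_div, le_div_iff₀ hbpos]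
    nlinarith [hα t]

section Gradient

variable {E : Type*} [NormedAddCommGroup E] [InnerProductSpace ℝ E] [CompleteSpace E]

/-- The descent lemma for a function with Lipschitz gradient. -/
theorem le_add_inner_gradient_of_lipschitz {f : E → ℝ} {L : ℝ} (hf : Differentiable ℝ f)
    (hL : ∀ p q, ‖gradient f p - gradient f q‖ ≤ L * ‖p - q‖) (p v : E) :
    f (p + v) ≤ f p + ⟪gradient f p, v⟫ + L / 2 * ‖v‖ ^ 2 := by
  have hder : ∀ t : ℝ, HasDerivAt
      (fun t : ℝ => f (p + t • v) - t * ⟪gradient f p, v⟫ - t ^ 2 * (L / 2 * ‖v‖ ^ 2))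
      (⟪gradient f (p + t • v), v⟫ - ⟪gradient f p, v⟫ - 2 * t * (L / 2 * ‖v‖ ^ 2)) t := by
    intro t
    have hline : HasDerivAt (fun t : ℝ => p + t • v) v t := by
      simpa using ((hasDerivAt_id t).smul_const v).const_add p
    have h1 := (hf (p + t • v)).hasGradientAt.hasFDerivAt.comp_hasDerivAt t hline
    have h2 := (hasDerivAt_id t).mul_const ⟪gradient f p, v⟫
    have h3 := (hasDerivAt_pow 2 t).mul_const (L / 2 * ‖v‖ ^ 2)
    exact ((h1.sub h2).sub h3).congr_deriv (by simp)
  have hanti := antitoneOn_of_deriv_nonpos (convex_Icc (0 : ℝ) 1)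
    (fun t _ => (hder t).continuousAt.continuousWithinAt)
    (fun t _ => (hder t).differentiableAt.differentiableWithinAt) (fun t ht => by
      rw [interior_Icc] at ht
      rw [(hder t).deriv, ← inner_sub_left]
      have h1 := real_inner_le_norm (gradient f (p + t • v) - gradient f p) v
      have h2 := hL (p + t • v) p
      rw [add_sub_cancel_left, norm_smul, Real.norm_of_nonneg ht.1.le] at h2
      nlinarith [norm_nonneg v, mul_le_mul_of_nonneg_right h2 (norm_nonneg v)])
  have h := hanti (Set.left_mem_Icc.2 zero_le_one) (Set.right_mem_Icc.2 zero_le_one) zero_le_one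
  simp only [one_smul, zero_smul, add_zero] at h
  linarith

/-- Gradient-related descent with step sizes in `[0, cl * (2 - ε) / (L * cu)]` of divergent sum
drives the gradient to `0`. -/
theorem tendsto_gradient_of_gradient_related {f : E → ℝ} {L cl cu ε : ℝ} {W g : ℕ → E}
    {α : ℕ → ℝ} (hf0 : ∀ p, 0 ≤ f p) (hf : Differentiable ℝ f)
    (hL : ∀ p q, ‖gradient f p - gradient f q‖ ≤ L * ‖p - q‖)
    (hLpos : 0 < L) (hcl : 0 < cl) (hcu : 0 < cu) (hε : 0 < ε)
    (hupd : ∀ t, W (t + 1) = W t - α t • g t)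
    (hg1 : ∀ t, cl * ‖gradient f (W t)‖ ^ 2 ≤ ⟪gradient f (W t), g t⟫)
    (hg2 : ∀ t, ‖g t‖ ^ 2 ≤ cu * ‖gradient f (W t)‖ ^ 2)
    (hα0 : ∀ t, 0 ≤ α t) (hα : ∀ t, α t ≤ cl * (2 - ε) / (L * cu)) (hsum : ¬ Summable α) :
    Tendsto (fun t => gradient f (W t)) atTop (nhds 0) := by
  set B := cl * (2 - ε) / (L * cu) with hB
  have key : Tendsto (fun t => ‖gradient f (W t)‖ ^ 2) atTop (nhds 0) := by
    refine tendsto_zero_of_sufficient_decrease (f := fun t => f (W t)) (α := α)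
      (c := cl * ε / 2) (K := L * √cu * (2 + L * √cu * B)) (by positivity)
      (fun t => hf0 _) (fun t => by positivity) hα0 (fun t => ?_) (fun t => ?_) hsum
    · have h := le_add_inner_gradient_of_lipschitz hf hL (W t) (-(α t • g t))
      rw [← sub_eq_add_neg, ← hupd, inner_neg_right, inner_smul_right, norm_neg, norm_smul,
        Real.norm_of_nonneg (hα0 t), mul_pow] at h
      have h1 := mul_le_mul_of_nonneg_left (hg1 t) (hα0 t)
      have h2 := mul_le_mul_of_nonneg_left (hg2 t) (by positivity : 0 ≤ L / 2 * α t ^ 2)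
      have h3 : α t * (L * cu) ≤ cl * (2 - ε) := (le_div_iff₀ (by positivity)).1 (hα t)
      have h4 := mul_le_mul_of_nonneg_right h3
        (mul_nonneg (hα0 t) (sq_nonneg ‖gradient f (W t)‖))
      linarith
    · have hgn : ‖g t‖ ≤ √cu * ‖gradient f (W t)‖ := by
        refine le_of_sq_le_sq ?_ (by positivity)
        rw [mul_pow, Real.sq_sqrt hcu.le]
        exact hg2 t
      set x := ‖gradient f (W t)‖
      set y := ‖gradient f (W (t + 1))‖
      have hd : |y - x| ≤ L * √cu * α t * x := by
        refine (abs_norm_sub_norm_le _ _).trans ((hL _ _).trans ?_)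
        rw [hupd, sub_sub_cancel_left, norm_neg, norm_smul, Real.norm_of_nonneg (hα0 t)]
        calc L * (α t * ‖g t‖) ≤ L * (α t * (√cu * x)) := by
              gcongr
              exact hα0 t
          _ = _ := by ring
      have hx : 0 ≤ x := norm_nonneg _
      have hy : 0 ≤ y := norm_nonneg _
      have hM : 0 ≤ L * √cu := by positivity
      generalize L * √cu = M at *
      have hs : |y + x| ≤ (2 + M * B) * x := by
        rw [abs_of_nonneg (by positivity)]
        have h5 : M * α t * x ≤ M * B * x := by
          gcongr
          exact hα t
        linarith [le_abs_self (y - x)]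
      calc |y ^ 2 - x ^ 2| = |y - x| * |y + x| := by rw [← abs_mul]; ring_nf
        _ ≤ (M * α t * x) * ((2 + M * B) * x) :=
            mul_le_mul hd hs (abs_nonneg _) ((abs_nonneg _).trans hd)
        _ = _ := by ring
  rw [tendsto_zero_iff_norm_tendsto_zero]
  simpa using key.sqrt

end Gradient

section LinearPredictor

variable {ι E G : Type*} [Fintype ι] [NormedAddCommGroup E] [InnerProductSpace ℝ E]
  [CompleteSpace E] [NormedAddCommGroup G] [InnerProductSpace ℝ G] [CompleteSpace G]

theorem hasGradientAt_const_mul_sum_comp {ℓ : ι → G → ℝ} (hℓ : ∀ i, Differentiable ℝ (ℓ i))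
    (A : ι → E →L[ℝ] G) (c : ℝ) (W : E) :
    HasGradientAt (fun W => c * ∑ i, ℓ i (A i W))
      (c • ∑ i, ContinuousLinearMap.adjoint (A i) (gradient (ℓ i) (A i W))) W := by
  rw [hasGradientAt_iff_hasFDerivAt]
  have h := (HasFDerivAt.fun_sum (u := Finset.univ) fun i _ =>
    (hℓ i (A i W)).hasGradientAt.hasFDerivAt.comp W (A i).hasFDerivAt).const_mul c
  refine h.congr_fderiv ?_
  ext V
  simp [ContinuousLinearMap.adjoint_inner_left]

theorem norm_gradient_const_mul_sum_comp_sub_le {ℓ : ι → G → ℝ}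
    (hℓ : ∀ i, Differentiable ℝ (ℓ i)) {L : ℝ} (hL0 : 0 ≤ L)
    (hL : ∀ i p q, ‖gradient (ℓ i) p - gradient (ℓ i) q‖ ≤ L * ‖p - q‖)
    (A : ι → E →L[ℝ] G) {Z : ι → ℝ} (hA : ∀ i, ‖A i‖ ≤ Z i) {c : ℝ} (hc : 0 ≤ c) (p q : E) :
    ‖gradient (fun W => c * ∑ i, ℓ i (A i W)) p - gradient (fun W => c * ∑ i, ℓ i (A i W)) q‖
      ≤ L * c * (∑ i, Z i ^ 2) * ‖p - q‖ := by
  rw [(hasGradientAt_const_mul_sum_comp hℓ A c p).gradient,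
    (hasGradientAt_const_mul_sum_comp hℓ A c q).gradient, ← smul_sub, ← Finset.sum_sub_distrib,
    norm_smul, Real.norm_of_nonneg hc]
  have h : ∀ i, ‖ContinuousLinearMap.adjoint (A i) (gradient (ℓ i) (A i p)) -
      ContinuousLinearMap.adjoint (A i) (gradient (ℓ i) (A i q))‖ ≤ L * Z i ^ 2 * ‖p - q‖ := by
    intro i
    have hZ : 0 ≤ Z i := (norm_nonneg _).trans (hA i)
    rw [← map_sub]
    calc _ ≤ ‖ContinuousLinearMap.adjoint (A i)‖ *
          ‖gradient (ℓ i) (A i p) - gradient (ℓ i) (A i q)‖ := ContinuousLinearMap.le_opNorm _ _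
      _ ≤ Z i * (L * (Z i * ‖p - q‖)) := by
        gcongr
        · rw [LinearIsometryEquiv.norm_map]
          exact hA i
        · refine (hL i _ _).trans ?_
          rw [← map_sub]
          gcongr
          exact (A i).le_of_opNorm_le (hA i) _
      _ = _ := by ring
  calc _ ≤ c * ∑ i, L * Z i ^ 2 * ‖p - q‖ := by
        gcongr
        exact norm_sum_le_of_le _ fun i _ => h i
    _ = _ := by
      rw [← Finset.sum_mul, ← Finset.mul_sum]
      ring

end LinearPredictor

/-- A block-diagonal linear map is bounded by the largest Euclidean norm of its rows. -/
theorem norm_le_mul_norm_of_blocks {ι κ : Type*} [Fintype ι] [Fintype κ] {b : ι → κ → ℝ}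
    {Z : ℝ} (hZ : 0 ≤ Z) (hb : ∀ j, √(∑ c, b j c ^ 2) ≤ Z)
    (W : EuclideanSpace ℝ (ι × κ)) (y : EuclideanSpace ℝ ι)
    (hy : ∀ j, y j = ∑ c, b j c * W (j, c)) : ‖y‖ ≤ Z * ‖W‖ := by
  refine le_of_sq_le_sq ?_ (by positivity)
  rw [mul_pow, EuclideanSpace.real_norm_sq_eq, EuclideanSpace.real_norm_sq_eq,
    Fintype.sum_prod_type, Finset.mul_sum]
  refine Finset.sum_le_sum fun j _ => ?_
  rw [hy]
  refine (Finset.sum_mul_sq_le_sq_mul_sq _ _ _).trans ?_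
  have hsq := (Real.sqrt_le_left hZ).1 (hb j)
  gcongr

theorem Matrix.exists_mulVec_eq_of_rank_eq {n : ℕ} {κ : Type*} [Fintype κ]
    {M : Matrix (Fin n) κ ℝ} (hM : M.rank = n) (y : Fin n → ℝ) : ∃ v, M.mulVec v = y := by
  have h : LinearMap.range M.mulVecLin = ⊤ :=
    Submodule.eq_top_of_finrank_eq (by rw [← Matrix.rank, hM]; simp)
  exact LinearMap.range_eq_top.1 h y

/-- Deterministic core of Theorem 5 (on the probability-one event of appendix Lemma
`lemma:4`): with invex losses having `L_ℓ`-Lipschitz gradients, under the rank condition and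
`L̂_c > 0`, every limit point of the exploitation-phase iterates is a global minimizer of
`L̂`. -/
theorem stmt_15
    (n mx mH mH1 d' my : ℕ) (hn : 0 < n) (hmy : 0 < my)
    (x : Fin n → Fin mx → ℝ)
    (z : (Fin mx → ℝ) → (Fin d' → ℝ) → (Fin mH1 → ℝ))
    (σt : ℝ → ℝ)
    (φ : (Fin mH1 → Fin mH → ℝ) → (Fin d' → ℝ) → Matrix (Fin n) (Fin mH × Fin mH1) ℝ)
    (hφ : ∀ q u i kl, φ q u i kl = σt (∑ l, z (x i) u l * q l kl.1) * z (x i) u kl.2)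
    (u : Fin d' → ℝ)
    (R : Fin my → Fin mH1 → Fin mH → ℝ)
    (a : Fin my → Fin mH → ℝ)
    (ℓ : Fin n → EuclideanSpace ℝ (Fin my) → ℝ)
    (hℓnn : ∀ i p, 0 ≤ ℓ i p)
    (Lℓ : ℝ) (hLℓ : 0 ≤ Lℓ)
    (hℓdiff : ∀ i, Differentiable ℝ (ℓ i))
    (hℓlip : ∀ i p q, ‖gradient (ℓ i) p - gradient (ℓ i) q‖ ≤ Lℓ * ‖p - q‖)
    -- invexity of each ℓ_i
    (ηinv : Fin n → EuclideanSpace ℝ (Fin my) → EuclideanSpace ℝ (Fin my) →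
      EuclideanSpace ℝ (Fin my))
    (hinvex : ∀ i p q, ℓ i q + ⟪gradient (ℓ i) q, ηinv i p q⟫ ≤ ℓ i p)
    (F : EuclideanSpace ℝ (Fin my × Fin mH × Fin mH1) → Fin n → EuclideanSpace ℝ (Fin my))
    (hF : ∀ W i j, F W i j =
      ∑ k, a j k * σt (∑ l, z (x i) u l * R j l k) * (∑ l, W (j, k, l) * z (x i) u l))
    (Lhat : EuclideanSpace ℝ (Fin my × Fin mH × Fin mH1) → ℝ)
    (hLhat : ∀ W, Lhat W = (1 / (n : ℝ)) * ∑ i, ℓ i (F W i))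
    -- the rank condition
    (hrank : ∀ j, (φ (R j) u *
      (Matrix.diagonal (a j) ⊗ₖ (1 : Matrix (Fin mH1) (Fin mH1) ℝ))).rank = n)
    -- the Lipschitz constant of ∇L̂ is positive
    (Z : Fin n → ℝ)
    (hZ : ∀ i, Z i = ⨆ j : Fin my,
      Real.sqrt (∑ c, (((Matrix.diagonal (a j) ⊗ₖ (1 : Matrix (Fin mH1) (Fin mH1) ℝ)).mulVec
        (fun c' => φ (R j) u i c')) c) ^ 2))
    (Lc : ℝ) (hLcdef : Lc = (Lℓ / (n : ℝ)) * ∑ i, Z i ^ 2) (hLc : 0 < Lc)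
    -- the iterates from time τ on
    (τ : ℕ) (cl cu : ℝ) (hcl : 0 < cl) (hcu : 0 < cu)
    (W g : ℕ → EuclideanSpace ℝ (Fin my × Fin mH × Fin mH1)) (α : ℕ → ℝ)
    (hupd : ∀ t, τ ≤ t → W (t + 1) = W t - α t • g t)
    (hg1 : ∀ t, τ ≤ t → cl * ‖gradient Lhat (W t)‖ ^ 2 ≤ ⟪gradient Lhat (W t), g t⟫)
    (hg2 : ∀ t, τ ≤ t → ‖g t‖ ^ 2 ≤ cu * ‖gradient Lhat (W t)‖ ^ 2)
    -- stepsize condition (i) or (ii)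
    (hstep :
      (∃ ε > (0 : ℝ), ∀ t, τ ≤ t → ε ≤ α t ∧ α t ≤ cl * (2 - ε) / (Lc * cu)) ∨
      ((∀ t, τ ≤ t → 0 ≤ α t) ∧ Tendsto α atTop (nhds 0) ∧
        Tendsto (fun N => ∑ t ∈ Finset.range N, α (τ + t)) atTop atTop))
    -- a limit point of the sequence (W^t)_{t ≥ τ}
    (What : EuclideanSpace ℝ (Fin my × Fin mH × Fin mH1))
    (hlimit : ∃ ψ : ℕ → ℕ, StrictMono ψ ∧ (∀ m, τ ≤ ψ m) ∧
      Tendsto (fun m => W (ψ m)) atTop (nhds What)) :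
    (∀ q : Fin n → EuclideanSpace ℝ (Fin my),
      Lhat What ≤ (1 / (n : ℝ)) * ∑ i, ℓ i (q i)) ∧
    (∀ W', Lhat What ≤ Lhat W') := by
  set M : Fin my → Matrix (Fin n) (Fin mH × Fin mH1) ℝ := fun j => φ (R j) u *
    (Matrix.diagonal (a j) ⊗ₖ (1 : Matrix (Fin mH1) (Fin mH1) ℝ)) with hMdef
  have hdiag : ∀ j, Matrix.diagonal (a j) ⊗ₖ (1 : Matrix (Fin mH1) (Fin mH1) ℝ) =
      Matrix.diagonal fun c => a j c.1 := by
    intro j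
    rw [← Matrix.diagonal_one, Matrix.diagonal_kronecker_diagonal]
    simp
  have hM : ∀ j i c, M j i c = φ (R j) u i c * a j c.1 := by
    intro j i c
    simp only [hMdef, hdiag, Matrix.mul_diagonal]
  have hFM : ∀ W i j, F W i j = ∑ c, M j i c * W (j, c) := by
    intro W i j
    simp only [hF, hM, hφ, Fintype.sum_prod_type, Finset.mul_sum]
    refine Finset.sum_congr rfl fun k _ => Finset.sum_congr rfl fun l _ => ?_
    ring
  have hZM : ∀ i, Z i = ⨆ j : Fin my, √(∑ c, M j i c ^ 2) := by
    intro i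
    simp only [hZ, hdiag, Matrix.mulVec_diagonal, hM, mul_comm]
  have hZ0 : ∀ i, 0 ≤ Z i := fun i => hZM i ▸ Real.iSup_nonneg fun _ => Real.sqrt_nonneg _
  let A : Fin n → EuclideanSpace ℝ (Fin my × Fin mH × Fin mH1) →L[ℝ] EuclideanSpace ℝ (Fin my) :=
    fun i => LinearMap.toContinuousLinearMap
      { toFun := fun W => F W i
        map_add' := fun V W => by
          ext j
          simp [hFM, mul_add, Finset.sum_add_distrib]
        map_smul' := fun r W => by
          ext j
          simp [hFM, Finset.mul_sum, mul_left_comm] }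
  have hA : ∀ i, ‖A i‖ ≤ Z i := fun i =>
    ContinuousLinearMap.opNorm_le_bound _ (hZ0 i) fun W =>
      norm_le_mul_norm_of_blocks (hZ0 i)
        (fun j => hZM i ▸ le_ciSup (f := fun j => √(∑ c, M j i c ^ 2))
          (Set.finite_range _).bddAbove j) W _ fun j => hFM W i j
  have hLA : Lhat = fun W => 1 / (n : ℝ) * ∑ i, ℓ i (A i W) := funext hLhat
  have hLip : ∀ p q, ‖gradient Lhat p - gradient Lhat q‖ ≤ Lc * ‖p - q‖ := by
    intro p q
    have h := norm_gradient_const_mul_sum_comp_sub_le hℓdiff hLℓ hℓlip A hA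
      (c := 1 / (n : ℝ)) (by positivity) p q
    rwa [← hLA, mul_one_div, ← hLcdef] at h
  have hgrad : ∀ W, HasGradientAt Lhat _ W := fun W =>
    hLA ▸ hasGradientAt_const_mul_sum_comp hℓdiff A (1 / (n : ℝ)) W
  have hLdiff : Differentiable ℝ Lhat := fun W => (hgrad W).differentiableAt
  have hL0 : ∀ W, 0 ≤ Lhat W := fun W => by
    rw [hLhat]
    exact mul_nonneg (by positivity) (Finset.sum_nonneg fun i _ => hℓnn _ _)
  obtain ⟨T, hT, ε, hε, hα0, hαB, hns⟩ : ∃ T, τ ≤ T ∧ ∃ ε > 0, (∀ t, 0 ≤ α (t + T)) ∧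
      (∀ t, α (t + T) ≤ cl * (2 - ε) / (Lc * cu)) ∧ ¬ Summable fun t => α (t + T) := by
    rcases hstep with ⟨ε, hε, h⟩ | ⟨h0, hlim, hdiv⟩
    · refine ⟨τ, le_rfl, ε, hε, fun t => hε.le.trans (h _ (by omega)).1,
        fun t => (h _ (by omega)).2, fun hs => ?_⟩
      exact hε.not_ge (ge_of_tendsto' hs.tendsto_atTop_zero fun t => (h _ (by omega)).1)
    · obtain ⟨N, hN⟩ := eventually_atTop.1 (hlim.eventually
        (ge_mem_nhds (show 0 < cl * (2 - 1) / (Lc * cu) by norm_num; positivity)))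
      refine ⟨max τ N, le_max_left _ _, 1, one_pos, fun t => h0 _ (by omega),
        fun t => hN _ (by omega), fun hs => ?_⟩
      have hs' : Summable fun t => α (τ + t) := by
        simpa only [add_comm τ] using (summable_nat_add_iff τ).2 ((summable_nat_add_iff _).1 hs)
      exact not_tendsto_nhds_of_tendsto_atTop hdiv _ hs'.hasSum.tendsto_sum_nat
  have hlim : Tendsto (fun t => gradient Lhat (W t)) atTop (nhds 0) := by
    rw [← tendsto_add_atTop_iff_nat T]
    refine tendsto_gradient_of_gradient_related (g := fun t => g (t + T)) hL0 hLdiff hLip hLc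
      hcl hcu hε (fun t => ?_) (fun t => hg1 _ (by omega)) (fun t => hg2 _ (by omega)) hα0 hαB hns
    rw [← hupd _ (by omega)]
    congr 1
    omega
  have hzero : gradient Lhat What = 0 := by
    obtain ⟨ψ, hψ, -, hψlim⟩ := hlimit
    have hcont : Continuous (gradient Lhat) :=
      (LipschitzWith.of_dist_le_mul (K := ⟨Lc, hLc.le⟩) fun p q => by
        rw [dist_eq_norm, dist_eq_norm]
        exact hLip p q).continuous
    exact tendsto_nhds_unique ((hcont.tendsto What).comp hψlim) (hlim.comp hψ.tendsto_atTop)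
  have hstat : ∀ V, ∑ i, ⟪gradient (ℓ i) (F What i), F V i⟫ = 0 := by
    intro V
    have h := (hgrad What).gradient
    rw [hzero, eq_comm, smul_eq_zero_iff_right (by positivity)] at h
    have h' := congrArg (fun v => ⟪v, V⟫) h
    simp only [sum_inner, ContinuousLinearMap.adjoint_inner_left, inner_zero_left] at h'
    exact h'
  have hsurj : ∀ y : Fin n → EuclideanSpace ℝ (Fin my), ∃ V, ∀ i, F V i = y i := by
    intro y
    choose v hv using fun j => Matrix.exists_mulVec_eq_of_rank_eq (hrank j) fun i => y i j
    refine ⟨WithLp.toLp 2 fun c => v c.1 c.2, fun i => ?_⟩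
    ext j
    rw [hFM]
    exact congrFun (hv j) i
  have hmain : ∀ q : Fin n → EuclideanSpace ℝ (Fin my),
      Lhat What ≤ (1 / (n : ℝ)) * ∑ i, ℓ i (q i) := by
    intro q
    obtain ⟨V, hV⟩ := hsurj fun i => ηinv i (q i) (F What i)
    have h := hstat V
    simp only [hV] at h
    have hsum := Finset.sum_le_sum fun i (_ : i ∈ Finset.univ) => hinvex i (q i) (F What i)
    rw [Finset.sum_add_distrib, h, add_zero] at hsum
    rw [hLhat]
    gcongr
  exact ⟨hmain, fun W' => (hmain (F W')).trans_eq (hLhat W').symm⟩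
end
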